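/- arXiv:1109.0168 — 5 statements merged into one kernel-verified Lean document; each statement's English description precedes it below -/
import Mathlib

section
/- Let p ≥ 1 be a real number and let γ_p := inf { ∫_ℝ (u'(t)² + |t|^p u(t)²) dt : u ∈ C_c^∞(ℝ), ∫_ℝ u(t)² dt = 1 }. If λ > γ_p, then the quadratic form of the operator L_p(λ) is unbounded from below: for every M > 0 there exists a real-valued ψ ∈ C_c^∞(ℝ²) with ∫_{ℝ²} ψ² dx dy = 1 such that ∫_{ℝ²} (|∇ψ(x,y)|² + (|xy|^p − λ(x²+y²)^{p/(p+2)}) ψ(x,y)²) dx dy < −M. -/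
open MeasureTheory Real

/-- A normalized smooth function on `ℝ` vanishing outside `[-1, 1]`. -/
theorem exists_contDiff_normalized_bump : ∃ h : ℝ → ℝ, ContDiff ℝ (⊤ : ℕ∞) h ∧
    HasCompactSupport h ∧ (∫ t : ℝ, (h t) ^ 2) = 1 ∧ ∀ t, h t ≠ 0 → |t| ≤ 1 := by
  let b : ContDiffBump (0 : ℝ) := ⟨1 / 2, 1, by norm_num, by norm_num⟩
  have hb : ContDiff ℝ (⊤ : ℕ∞) b := b.contDiff
  have hpos : 0 < ∫ t : ℝ, (b t) ^ 2 := by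
    refine Continuous.integral_pos_of_hasCompactSupport_nonneg_nonzero (x := 0)
      (hb.continuous.pow 2) ?_ (fun t => sq_nonneg _) ?_
    · exact b.hasCompactSupport.comp_left (g := fun x : ℝ => x ^ 2) (by simp)
    · have : b 0 = 1 := b.one_of_mem_closedBall (by simp [b])
      simp [this]
  refine ⟨fun t => (√(∫ t : ℝ, (b t) ^ 2))⁻¹ * b t, contDiff_const.mul hb,
    b.hasCompactSupport.mul_left, ?_, fun t ht => ?_⟩
  · simp_rw [mul_pow, inv_pow, Real.sq_sqrt hpos.le]
    rw [integral_const_mul, inv_mul_cancel₀ hpos.ne']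
  · by_contra! hlt
    refine ht ?_
    have : b t = 0 := b.zero_of_le_dist (by simpa [b] using hlt.le)
    simp [this]

theorem integral_mul_comp_mul_left (F : ℝ → ℝ) {a : ℝ} (ha : 0 < a) :
    (∫ y : ℝ, a * F (a * y)) = ∫ t : ℝ, F t := by
  rw [integral_const_mul, Measure.integral_comp_mul_left, abs_of_pos (inv_pos.2 ha), smul_eq_mul,
    mul_inv_cancel_left₀ ha.ne']

section ProductEnergy

variable {f g : ℝ → ℝ}

theorem hasCompactSupport_prod_mul (hfs : HasCompactSupport f) (hgs : HasCompactSupport g) :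
    HasCompactSupport fun v : ℝ × ℝ => f v.1 * g v.2 := by
  refine HasCompactSupport.intro (hfs.isCompact.prod hgs.isCompact) fun v hv => ?_
  by_contra! hne
  exact hv ⟨subset_tsupport f (left_ne_zero_of_mul hne),
    subset_tsupport g (right_ne_zero_of_mul hne)⟩

theorem fderiv_prod_mul (hf : Differentiable ℝ f) (hg : Differentiable ℝ g) (v : ℝ × ℝ) :
    fderiv ℝ (fun v : ℝ × ℝ => f v.1 * g v.2) v (1, 0) = deriv f v.1 * g v.2 ∧
      fderiv ℝ (fun v : ℝ × ℝ => f v.1 * g v.2) v (0, 1) = f v.1 * deriv g v.2 := by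
  have h1 : HasFDerivAt (fun v : ℝ × ℝ => f v.1) (deriv f v.1 • ContinuousLinearMap.fst ℝ ℝ ℝ) v :=
    (hf v.1).hasDerivAt.comp_hasFDerivAt v (ContinuousLinearMap.fst ℝ ℝ ℝ).hasFDerivAt
  have h2 : HasFDerivAt (fun v : ℝ × ℝ => g v.2) (deriv g v.2 • ContinuousLinearMap.snd ℝ ℝ ℝ) v :=
    (hg v.2).hasDerivAt.comp_hasFDerivAt v (ContinuousLinearMap.snd ℝ ℝ ℝ).hasFDerivAt
  have h : HasFDerivAt (fun v : ℝ × ℝ => f v.1 * g v.2) _ v := h1.mul h2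
  rw [h.fderiv]
  constructor <;> simp [mul_comm]

/-- A bound for the energy of a product function whose first factor lives on `[R, S]`. -/
theorem product_energy_le {p lam R S : ℝ} (hp : 0 ≤ p) (hlam : 0 ≤ lam) (hR : 0 ≤ R)
    (hf : ContDiff ℝ (⊤ : ℕ∞) f) (hfs : HasCompactSupport f)
    (hg : ContDiff ℝ (⊤ : ℕ∞) g) (hgs : HasCompactSupport g)
    (hf1 : (∫ x : ℝ, (f x) ^ 2) = 1) (hg1 : (∫ y : ℝ, (g y) ^ 2) = 1)
    (hfR : ∀ x, f x ≠ 0 → R ≤ x ∧ x ≤ S) :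
    (∫ v : ℝ × ℝ, ((fderiv ℝ (fun v : ℝ × ℝ => f v.1 * g v.2) v (1, 0)) ^ 2 +
        (fderiv ℝ (fun v : ℝ × ℝ => f v.1 * g v.2) v (0, 1)) ^ 2 +
        (|v.1 * v.2| ^ p - lam * (v.1 ^ 2 + v.2 ^ 2) ^ (p / (p + 2))) * (f v.1 * g v.2) ^ 2)) ≤
      (∫ x : ℝ, (deriv f x) ^ 2) + (∫ y : ℝ, (deriv g y) ^ 2) +
        S ^ p * (∫ y : ℝ, |y| ^ p * (g y) ^ 2) - lam * (R ^ 2) ^ (p / (p + 2)) := by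
  have hs : 0 ≤ p / (p + 2) := by positivity
  have hfc := hf.continuous
  have hgc := hg.continuous
  have hf'c : Continuous (deriv f) := hf.continuous_deriv (by simp)
  have hg'c : Continuous (deriv g) := hg.continuous_deriv (by simp)
  have sq {k : ℝ → ℝ} (hk : HasCompactSupport k) : HasCompactSupport fun t => (k t) ^ 2 :=
    hk.comp_left (g := fun x : ℝ => x ^ 2) (by simp)
  have habs : Continuous fun y : ℝ => |y| ^ p :=
    continuous_abs.rpow_const fun _ => Or.inr hp
  have if2 : Integrable fun x => (f x) ^ 2 :=
    (hfc.pow 2).integrable_of_hasCompactSupport (sq hfs)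
  have ig2 : Integrable fun x => (g x) ^ 2 :=
    (hgc.pow 2).integrable_of_hasCompactSupport (sq hgs)
  have if'2 : Integrable fun x => (deriv f x) ^ 2 :=
    (hf'c.pow 2).integrable_of_hasCompactSupport (sq hfs.deriv)
  have ig'2 : Integrable fun x => (deriv g x) ^ 2 :=
    (hg'c.pow 2).integrable_of_hasCompactSupport (sq hgs.deriv)
  have igp : Integrable fun y => |y| ^ p * (g y) ^ 2 :=
    (habs.mul (hgc.pow 2)).integrable_of_hasCompactSupport (sq hgs).mul_left
  have J1 : Integrable fun v : ℝ × ℝ => (deriv f v.1) ^ 2 * (g v.2) ^ 2 := if'2.mul_prod ig2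
  have J2 : Integrable fun v : ℝ × ℝ => (f v.1) ^ 2 * (deriv g v.2) ^ 2 := if2.mul_prod ig'2
  have J3 : Integrable fun v : ℝ × ℝ => (f v.1) ^ 2 * (|v.2| ^ p * (g v.2) ^ 2) :=
    if2.mul_prod igp
  have J4 : Integrable fun v : ℝ × ℝ => (f v.1) ^ 2 * (g v.2) ^ 2 := if2.mul_prod ig2
  have J5 : Integrable fun v : ℝ × ℝ =>
      (|v.1 * v.2| ^ p - lam * (v.1 ^ 2 + v.2 ^ 2) ^ (p / (p + 2))) * (f v.1 * g v.2) ^ 2 := by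
    refine Continuous.integrable_of_hasCompactSupport ?_ ?_
    · refine Continuous.mul (Continuous.sub ?_ (continuous_const.mul ?_)) (by fun_prop)
      · exact Continuous.rpow_const (by fun_prop) fun _ => Or.inr hp
      · exact Continuous.rpow_const (by fun_prop) fun _ => Or.inr hs
    · exact ((hasCompactSupport_prod_mul hfs hgs).comp_left
        (g := fun x : ℝ => x ^ 2) (by simp)).mul_left
  have J12 : Integrable fun v : ℝ × ℝ =>
      (deriv f v.1) ^ 2 * (g v.2) ^ 2 + (f v.1) ^ 2 * (deriv g v.2) ^ 2 := J1.add J2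
  have J34 : Integrable fun v : ℝ × ℝ => S ^ p * ((f v.1) ^ 2 * (|v.2| ^ p * (g v.2) ^ 2)) -
      lam * (R ^ 2) ^ (p / (p + 2)) * ((f v.1) ^ 2 * (g v.2) ^ 2) :=
    (J3.const_mul _).sub (J4.const_mul _)
  have key : ∀ v : ℝ × ℝ,
      (|v.1 * v.2| ^ p - lam * (v.1 ^ 2 + v.2 ^ 2) ^ (p / (p + 2))) * (f v.1 * g v.2) ^ 2 ≤
        S ^ p * ((f v.1) ^ 2 * (|v.2| ^ p * (g v.2) ^ 2)) -
          lam * (R ^ 2) ^ (p / (p + 2)) * ((f v.1) ^ 2 * (g v.2) ^ 2) := by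
    intro v
    by_cases h0 : f v.1 = 0
    · simp [h0]
    obtain ⟨hR1, hS1⟩ := hfR _ h0
    have hx : 0 ≤ v.1 := hR.trans hR1
    have h1 : |v.1 * v.2| ^ p ≤ S ^ p * |v.2| ^ p := by
      rw [abs_mul, abs_of_nonneg hx, Real.mul_rpow hx (abs_nonneg _)]
      gcongr
    have h2 : (R ^ 2) ^ (p / (p + 2)) ≤ (v.1 ^ 2 + v.2 ^ 2) ^ (p / (p + 2)) := by
      refine Real.rpow_le_rpow (by positivity) ?_ hs
      nlinarith [sq_nonneg v.2]
    have h3 := mul_le_mul_of_nonneg_left h2 hlam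
    have h4 := mul_le_mul_of_nonneg_right (sub_le_sub h1 h3) (sq_nonneg (f v.1 * g v.2))
    refine h4.trans_eq (by ring)
  have hfd := fderiv_prod_mul (hf.differentiable (by simp)) (hg.differentiable (by simp))
  simp_rw [fun v => (hfd v).1, fun v => (hfd v).2]
  calc _ ≤ ∫ v : ℝ × ℝ, ((deriv f v.1) ^ 2 * (g v.2) ^ 2 + (f v.1) ^ 2 * (deriv g v.2) ^ 2 +
        (S ^ p * ((f v.1) ^ 2 * (|v.2| ^ p * (g v.2) ^ 2)) -
          lam * (R ^ 2) ^ (p / (p + 2)) * ((f v.1) ^ 2 * (g v.2) ^ 2))) := by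
        refine integral_mono ?_ ?_ fun v => ?_
        · simp only [mul_pow] at J5 ⊢
          exact J12.add J5
        · exact J12.add J34
        · simp only [mul_pow] at key ⊢
          linarith [key v]
    _ = _ := by
        rw [integral_add J12 J34, integral_add J1 J2,
          integral_sub (J3.const_mul _) (J4.const_mul _), integral_const_mul, integral_const_mul]
        simp only [Measure.volume_eq_prod]
        rw [integral_prod_mul (fun x => (deriv f x) ^ 2) fun y => (g y) ^ 2,
          integral_prod_mul (fun x => (f x) ^ 2) fun y => (deriv g y) ^ 2,
          integral_prod_mul (fun x => (f x) ^ 2) fun y => |y| ^ p * (g y) ^ 2,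
          integral_prod_mul (fun x => (f x) ^ 2) fun y => (g y) ^ 2, hf1, hg1]
        ring

end ProductEnergy

/-- The dilation `y ↦ √a u(a y)` preserves the `L²` norm and scales both parts of the energy. -/
theorem dilation_energy (u : ℝ → ℝ) (p : ℝ) {a : ℝ} (ha : 0 < a) :
    (∫ y : ℝ, (√a * u (a * y)) ^ 2) = (∫ t : ℝ, (u t) ^ 2) ∧
      (∫ y : ℝ, (deriv (fun y => √a * u (a * y)) y) ^ 2) = a ^ 2 * ∫ t : ℝ, (deriv u t) ^ 2 ∧
      (∫ y : ℝ, |y| ^ p * (√a * u (a * y)) ^ 2) = a ^ (-p) * ∫ t : ℝ, |t| ^ p * (u t) ^ 2 := by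
  refine ⟨?_, ?_, ?_⟩
  · rw [← integral_mul_comp_mul_left (fun t => (u t) ^ 2) ha]
    simp_rw [mul_pow, Real.sq_sqrt ha.le]
  · rw [← integral_mul_comp_mul_left (fun t => (deriv u t) ^ 2) ha, ← integral_const_mul]
    congr 1 with y
    rw [deriv_const_mul_field, deriv_comp_mul_left, smul_eq_mul, mul_pow, Real.sq_sqrt ha.le]
    ring
  · rw [← integral_mul_comp_mul_left (fun t => |t| ^ p * (u t) ^ 2) ha, ← integral_const_mul]
    congr 1 with y
    have h : a ^ (-p) * a ^ p = 1 := by rw [← Real.rpow_add ha]; simp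
    rw [mul_pow, Real.sq_sqrt ha.le, abs_mul, abs_of_pos ha,
      Real.mul_rpow ha.le (abs_nonneg _)]
    linear_combination (-(a * |y| ^ p * (u (a * y)) ^ 2)) * h

theorem tendsto_trial_energy {p lam C K V : ℝ} (hp : 0 < p) (h : K + V < lam) :
    Filter.Tendsto (fun R : ℝ => C + (R ^ 2) ^ (p / (p + 2)) * (K + (1 + 2 / R) ^ p * V - lam))
      Filter.atTop Filter.atBot := by
  have hs : 0 < p / (p + 2) := by positivity
  have h1 : Filter.Tendsto (fun R : ℝ => (R ^ 2) ^ (p / (p + 2))) Filter.atTop Filter.atTop :=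
    (tendsto_rpow_atTop hs).comp (Filter.tendsto_pow_atTop two_ne_zero)
  have h2 : Filter.Tendsto (fun R : ℝ => (1 + 2 / R) ^ p) Filter.atTop (nhds 1) := by
    have h3 : Filter.Tendsto (fun R : ℝ => 1 + 2 / R) Filter.atTop (nhds (1 + 0)) :=
      (Filter.Tendsto.div_atTop tendsto_const_nhds Filter.tendsto_id).const_add 1
    simpa using h3.rpow_const (p := p) (Or.inr hp.le)
  have h4 : Filter.Tendsto (fun R : ℝ => K + (1 + 2 / R) ^ p * V - lam) Filter.atTop
      (nhds (K + 1 * V - lam)) := ((h2.mul_const V).const_add K).sub_const lam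
  exact Filter.tendsto_atBot_add_const_left _ _ (h1.atTop_mul_neg (by linarith) h4)

/-- If `λ > γ_p`, the quadratic form of `L_p(λ)` is unbounded from below. -/
theorem supercritical_unbounded_below (p : ℝ) (hp : 1 ≤ p) (lam : ℝ)
    (hlam : sInf {E : ℝ | ∃ u : ℝ → ℝ, ContDiff ℝ (⊤ : ℕ∞) u ∧ HasCompactSupport u ∧
        (∫ t : ℝ, (u t) ^ 2) = 1 ∧
        E = ∫ t : ℝ, ((deriv u t) ^ 2 + |t| ^ p * (u t) ^ 2)} < lam) :
    ∀ M > (0 : ℝ), ∃ ψ : ℝ × ℝ → ℝ, ContDiff ℝ (⊤ : ℕ∞) ψ ∧ HasCompactSupport ψ ∧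
      (∫ v : ℝ × ℝ, (ψ v) ^ 2) = 1 ∧
      (∫ v : ℝ × ℝ, ((fderiv ℝ ψ v (1, 0)) ^ 2 + (fderiv ℝ ψ v (0, 1)) ^ 2 +
        (|v.1 * v.2| ^ p - lam * (v.1 ^ 2 + v.2 ^ 2) ^ (p / (p + 2))) * (ψ v) ^ 2)) < -M := by
  intro M _
  have hp0 : 0 < p := by linarith
  obtain ⟨h, hh, hhs, hh1, hhb⟩ := exists_contDiff_normalized_bump
  obtain ⟨E, ⟨u, hu, hus, hu1, rfl⟩, hE⟩ := exists_lt_of_csInf_lt (by exact ⟨_, h, hh, hhs, hh1, rfl⟩) hlam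
  have hlam0 : 0 ≤ lam := (integral_nonneg fun t => by positivity).trans hE.le
  have sq {k : ℝ → ℝ} (hk : HasCompactSupport k) : HasCompactSupport fun t => (k t) ^ 2 :=
    hk.comp_left (g := fun x : ℝ => x ^ 2) (by simp)
  have hK : Integrable fun t => (deriv u t) ^ 2 :=
    ((hu.continuous_deriv (by simp)).pow 2).integrable_of_hasCompactSupport (sq hus.deriv)
  have hV : Integrable fun t => |t| ^ p * (u t) ^ 2 :=
    ((continuous_abs.rpow_const fun _ => Or.inr hp0.le).mul
      (hu.continuous.pow 2)).integrable_of_hasCompactSupport (sq hus).mul_left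
  rw [integral_add hK hV] at hE
  obtain ⟨R, hRM, hR⟩ := (((tendsto_trial_energy (C := ∫ x : ℝ, (deriv h x) ^ 2) hp0
    hE).eventually_lt_atBot (-M)).and (Filter.eventually_gt_atTop 0)).exists
  set a := R ^ (p / (p + 2)) with ha_def
  have ha : 0 < a := Real.rpow_pos_of_pos hR _
  have haa : a ^ 2 = (R ^ 2) ^ (p / (p + 2)) := by
    rw [ha_def, ← Real.rpow_natCast, ← Real.rpow_natCast, ← Real.rpow_mul hR.le,
      ← Real.rpow_mul hR.le, mul_comm]
  have hpot : (R + 2) ^ p * a ^ (-p) = (R ^ 2) ^ (p / (p + 2)) * (1 + 2 / R) ^ p := by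
    have e : R + 2 = R * (1 + 2 / R) := by field_simp
    rw [e, Real.mul_rpow hR.le (by positivity), ha_def, ← Real.rpow_natCast,
      ← Real.rpow_mul hR.le, ← Real.rpow_mul hR.le, mul_right_comm, ← Real.rpow_add hR]
    congr 2
    push_cast
    field_simp
    ring
  obtain ⟨hg1, hg2, hg3⟩ := dilation_energy u p ha
  have hg : ContDiff ℝ (⊤ : ℕ∞) fun y => √a * u (a * y) :=
    contDiff_const.mul (hu.comp (contDiff_const.mul contDiff_id))
  have hgs : HasCompactSupport fun y => √a * u (a * y) :=
    (hus.comp_homeomorph (Homeomorph.mulLeft₀ a ha.ne')).mul_left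
  have hf : ContDiff ℝ (⊤ : ℕ∞) fun x => h (x - (R + 1)) := hh.comp (contDiff_id.sub contDiff_const)
  have hfs : HasCompactSupport fun x => h (x - (R + 1)) :=
    hhs.comp_homeomorph (Homeomorph.subRight (R + 1))
  have hf1 : (∫ x : ℝ, (h (x - (R + 1))) ^ 2) = 1 := by
    rw [integral_sub_right_eq_self (fun x => (h x) ^ 2), hh1]
  have hf2 : (∫ x : ℝ, (deriv (fun x => h (x - (R + 1))) x) ^ 2) = ∫ x : ℝ, (deriv h x) ^ 2 := by
    simp_rw [deriv_comp_sub_const]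
    exact integral_sub_right_eq_self (fun x => (deriv h x) ^ 2) _
  rw [hu1] at hg1
  refine ⟨fun v => h (v.1 - (R + 1)) * (√a * u (a * v.2)),
    (hf.comp contDiff_fst).mul (hg.comp contDiff_snd), hasCompactSupport_prod_mul hfs hgs, ?_, ?_⟩
  · simp_rw [mul_pow (h _), Measure.volume_eq_prod]
    rw [integral_prod_mul (fun x => (h (x - (R + 1))) ^ 2) fun y => (√a * u (a * y)) ^ 2, hf1, hg1,
      one_mul]
  · refine (product_energy_le (R := R) (S := R + 2) hp0.le hlam0 hR.le hf hfs hg hgs hf1 hg1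
      fun x hx => ?_).trans_lt ?_
    · have := abs_le.1 (hhb _ hx)
      constructor <;> linarith
    · rw [hf2, hg2, hg3, ← mul_assoc, hpot, haa]
      refine lt_of_eq_of_lt ?_ hRM
      ring
end

section
/- Let p ≥ 1 be a real number and let γ_p := inf { ∫_ℝ (u'(t)² + |t|^p u(t)²) dt : u ∈ C_c^∞(ℝ), ∫_ℝ u(t)² dt = 1 }. If 0 ≤ λ < γ_p, then the quadratic form of L_p(λ) is bounded from below: there exists a constant C ∈ ℝ such that for every real-valued ψ ∈ C_c^∞(ℝ²) with ∫_{ℝ²} ψ² dx dy = 1 one has ∫_{ℝ²} (|∇ψ(x,y)|² + (|xy|^p − λ(x²+y²)^{p/(p+2)}) ψ(x,y)²) dx dy ≥ C. -/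
open MeasureTheory Real

/-- A continuous weight times the square of a continuous compactly supported function is
integrable. -/
lemma integrable_weight_mul_sq {X : Type*} [TopologicalSpace X] [MeasurableSpace X]
    [OpensMeasurableSpace X] {μ : Measure X} [IsFiniteMeasureOnCompacts μ] {w f : X → ℝ}
    (hw : Continuous w) (hf : Continuous f) (hc : HasCompactSupport f) :
    Integrable (fun x => w x * f x ^ 2) μ := by
  apply Continuous.integrable_of_hasCompactSupport (by fun_prop)
  have : (fun x => w x * f x ^ 2) = (fun x => w x * f x) * f := by
    ext x; simp only [Pi.mul_apply]; ring
  rw [this]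
  exact hc.mul_left

lemma integrable_sq_of_hasCompactSupport {X : Type*} [TopologicalSpace X] [MeasurableSpace X]
    [OpensMeasurableSpace X] {μ : Measure X} [IsFiniteMeasureOnCompacts μ] {f : X → ℝ}
    (hf : Continuous f) (hc : HasCompactSupport f) :
    Integrable (fun x => f x ^ 2) μ := by
  simpa using integrable_weight_mul_sq (μ := μ) (w := fun _ => 1) continuous_const hf hc

/-- The ground-state energy of the anharmonic oscillator `-d²/dt² + |t|^p`. -/
noncomputable def oscillatorEnergy (p : ℝ) : ℝ :=
  sInf {E : ℝ | ∃ u : ℝ → ℝ, ContDiff ℝ (⊤ : ℕ∞) u ∧ HasCompactSupport u ∧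
        (∫ t : ℝ, (u t) ^ 2) = 1 ∧
        E = ∫ t : ℝ, ((deriv u t) ^ 2 + |t| ^ p * (u t) ^ 2)}

/-- The variational inequality for functions that need not be normalized. -/
lemma oscillatorEnergy_mul_le (p : ℝ) {u : ℝ → ℝ} (hu : ContDiff ℝ (⊤ : ℕ∞) u)
    (hc : HasCompactSupport u) :
    oscillatorEnergy p * ∫ t, u t ^ 2 ≤ ∫ t, (deriv u t ^ 2 + |t| ^ p * u t ^ 2) := by
  have h0 : 0 ≤ ∫ t, u t ^ 2 := integral_nonneg fun t => sq_nonneg _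
  rcases h0.eq_or_lt with h | h
  · rw [← h, mul_zero]
    exact integral_nonneg fun t => by positivity
  set m := ∫ t, u t ^ 2 with hm
  have hs : (√m)⁻¹ ^ 2 = m⁻¹ := by rw [inv_pow, sq_sqrt h0]
  have hd : ∀ t, deriv (fun t => (√m)⁻¹ * u t) t = (√m)⁻¹ * deriv u t := fun t =>
    deriv_const_mul _ (hu.differentiable (by simp) t)
  have key : oscillatorEnergy p ≤ m⁻¹ * ∫ t, (deriv u t ^ 2 + |t| ^ p * u t ^ 2) := by
    apply csInf_le
    · refine ⟨0, ?_⟩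
      rintro E ⟨v, -, -, -, rfl⟩
      exact integral_nonneg fun t => by positivity
    · refine ⟨fun t => (√m)⁻¹ * u t, contDiff_const.mul hu, hc.mul_left, ?_, ?_⟩
      · simp_rw [mul_pow, hs]
        rw [integral_const_mul, ← hm, inv_mul_cancel₀ h.ne']
      · simp_rw [hd, mul_pow, hs]
        rw [← integral_const_mul]
        congr 1; ext t; ring
  rw [inv_mul_eq_div, le_div_iff₀ h] at key
  exact key

/-- The variational inequality with the potential rescaled by a coupling `a`. -/
lemma oscillatorEnergy_mul_le_scaled {p : ℝ} (hp : 0 < p) (a : ℝ) {u : ℝ → ℝ}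
    (hu : ContDiff ℝ (⊤ : ℕ∞) u) (hc : HasCompactSupport u) :
    oscillatorEnergy p * (a ^ 2) ^ (p / (p + 2)) * ∫ t, u t ^ 2 ≤
      ∫ t, (deriv u t ^ 2 + |a * t| ^ p * u t ^ 2) := by
  have hq : 0 < p / (p + 2) := by positivity
  rcases eq_or_ne a 0 with rfl | ha
  · rw [zero_pow two_ne_zero, zero_rpow hq.ne', mul_zero, zero_mul]
    exact integral_nonneg fun t => by positivity
  have ha' : 0 < |a| := abs_pos.2 ha
  set b := |a| ^ (p / (p + 2)) with hb
  have hb0 : 0 < b := rpow_pos_of_pos ha' _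
  have hb2 : (a ^ 2) ^ (p / (p + 2)) = b ^ 2 := by
    rw [← sq_abs, hb, ← rpow_natCast, ← rpow_natCast, ← rpow_mul ha'.le, ← rpow_mul ha'.le,
      mul_comm]
  have hbp : b ^ 2 * b ^ p = |a| ^ p := by
    rw [← rpow_natCast, ← rpow_add hb0, hb, ← rpow_mul ha'.le]
    congr 1
    push_cast
    field_simp
    ring
  set v : ℝ → ℝ := fun s => u (b⁻¹ * s) with hv
  have hvs : ContDiff ℝ (⊤ : ℕ∞) v := hu.comp (contDiff_const.mul contDiff_id)
  have hvc : HasCompactSupport v :=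
    hc.comp_homeomorph (Homeomorph.mulLeft₀ b⁻¹ (inv_ne_zero hb0.ne'))
  have hvu : ∀ t, v (b * t) = u t := fun t => by simp [hv, hb0.ne']
  have hdv : ∀ t, b * deriv v (b * t) = deriv u t := fun t => by
    have h : u = fun t => v (b * t) := funext fun t => (hvu t).symm
    conv_rhs => rw [h]
    exact (deriv_comp_mul_left b v t).symm
  have h1 : ∫ t, u t ^ 2 = b⁻¹ * ∫ s, v s ^ 2 := by
    have := Measure.integral_comp_mul_left (fun s => v s ^ 2) b
    simp only [hvu, abs_of_pos (inv_pos.2 hb0), smul_eq_mul] at this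
    exact this
  have h2 : ∫ t, (deriv u t ^ 2 + |a * t| ^ p * u t ^ 2) =
      b ^ 2 * (b⁻¹ * ∫ s, (deriv v s ^ 2 + |s| ^ p * v s ^ 2)) := by
    have := Measure.integral_comp_mul_left (fun s => deriv v s ^ 2 + |s| ^ p * v s ^ 2) b
    simp only [hvu, abs_of_pos (inv_pos.2 hb0), smul_eq_mul] at this
    rw [← this, ← integral_const_mul]
    congr 1; ext t
    rw [← hdv, abs_mul, abs_mul, mul_rpow (abs_nonneg _) (abs_nonneg _),
      mul_rpow (abs_nonneg _) (abs_nonneg _), abs_of_pos hb0, ← hbp]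
    ring
  rw [h1, h2, hb2]
  have := mul_le_mul_of_nonneg_left (oscillatorEnergy_mul_le p hvs hvc)
    (by positivity : 0 ≤ b ^ 2 * b⁻¹)
  linarith

/-- A localized version of the variational inequality: below the ground-state energy, the cost of
inserting a cutoff is absorbed by a constant that does not depend on the coupling. -/
lemma exists_localized_oscillator_bound {p lam : ℝ} (hp : 0 < p) (hlam0 : 0 ≤ lam)
    (hlam : lam < oscillatorEnergy p) {χ : ℝ → ℝ} (hχ : ContDiff ℝ (⊤ : ℕ∞) χ)
    (hχc : HasCompactSupport χ) (hχ1 : ∀ t, χ t ^ 2 ≤ 1) :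
    ∃ K : ℝ, ∀ (a : ℝ) (f : ℝ → ℝ), ContDiff ℝ (⊤ : ℕ∞) f → HasCompactSupport f →
      0 ≤ ∫ t, (deriv f t ^ 2 +
        (K + |a * t| ^ p * χ t ^ 2 - lam * (a ^ 2) ^ (p / (p + 2)) * χ t ^ 2) * f t ^ 2) := by
  have hχd : Continuous (deriv χ) := hχ.continuous_deriv (by simp)
  obtain ⟨B, hB⟩ := hχd.bounded_above_of_compact_support hχc.deriv
  have hB0 : 0 ≤ B := (norm_nonneg _).trans (hB 0)
  have hB2 : ∀ t, deriv χ t ^ 2 ≤ B ^ 2 := fun t => by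
    rw [← sq_abs]; exact pow_le_pow_left₀ (abs_nonneg _) (hB t) 2
  set ε := (oscillatorEnergy p - lam) / (lam + 1) with hε
  have hε0 : 0 < ε := div_pos (sub_pos.2 hlam) (by linarith)
  have hεlam : (1 + ε) * lam ≤ oscillatorEnergy p := by
    have : ε * (lam + 1) = oscillatorEnergy p - lam := by rw [hε]; field_simp
    nlinarith
  refine ⟨ε⁻¹ * B ^ 2, fun a f hf hc => ?_⟩
  have hfd : Continuous (deriv f) := hf.continuous_deriv (by simp)
  have hfc := hf.continuous
  have hχc' := hχ.continuous
  have hpow : Continuous fun t : ℝ => |a * t| ^ p :=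
    (continuous_const.mul continuous_id).abs.rpow_const fun _ => Or.inr hp.le
  have hgs : ContDiff ℝ (⊤ : ℕ∞) (fun t => χ t * f t) := hχ.mul hf
  have hgc : HasCompactSupport (fun t => χ t * f t) := hc.mul_left
  have hgd : ∀ t, deriv (fun t => χ t * f t) t = deriv χ t * f t + χ t * deriv f t := fun t =>
    deriv_fun_mul (hχ.differentiable (by simp) t) (hf.differentiable (by simp) t)
  set A := (a ^ 2) ^ (p / (p + 2)) with hA
  have hA0 : 0 ≤ A := by positivity
  have i1 : Integrable (fun t => deriv f t ^ 2) :=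
    integrable_sq_of_hasCompactSupport hfd hc.deriv
  have i2 : Integrable (fun t => (χ t * f t) ^ 2) :=
    integrable_sq_of_hasCompactSupport (hχc'.mul hfc) hgc
  have i3 : Integrable (fun t => (ε⁻¹ * B ^ 2 + |a * t| ^ p * χ t ^ 2) * f t ^ 2) :=
    integrable_weight_mul_sq (by fun_prop) hfc hc
  have i6 : Integrable (fun t =>
      deriv f t ^ 2 + (ε⁻¹ * B ^ 2 + |a * t| ^ p * χ t ^ 2) * f t ^ 2) := i1.add i3
  have i4 : Integrable (fun t => deriv (fun t => χ t * f t) t ^ 2) :=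
    integrable_sq_of_hasCompactSupport (hgs.continuous_deriv (by simp)) hgc.deriv
  have i5 : Integrable (fun t => |a * t| ^ p * (χ t * f t) ^ 2) :=
    integrable_weight_mul_sq hpow (hχc'.mul hfc) hgc
  have step : ∫ t, (deriv (fun t => χ t * f t) t ^ 2 + |a * t| ^ p * (χ t * f t) ^ 2) ≤
      ∫ t, (1 + ε) *
        (deriv f t ^ 2 + (ε⁻¹ * B ^ 2 + |a * t| ^ p * χ t ^ 2) * f t ^ 2) := by
    refine integral_mono (i4.add i5) (i6.const_mul _) fun t => ?_
    have hV : 0 ≤ |a * t| ^ p * χ t ^ 2 * f t ^ 2 := by positivity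
    have e1 : (deriv χ t * f t + χ t * deriv f t) ^ 2 ≤
        (1 + ε) * (χ t * deriv f t) ^ 2 + (1 + ε⁻¹) * (deriv χ t * f t) ^ 2 := by
      have : (1 + ε) * (χ t * deriv f t) ^ 2 + (1 + ε⁻¹) * (deriv χ t * f t) ^ 2 -
          (deriv χ t * f t + χ t * deriv f t) ^ 2 =
          ε⁻¹ * (ε * (χ t * deriv f t) - deriv χ t * f t) ^ 2 := by
        field_simp; ring
      have h' : 0 ≤ ε⁻¹ * (ε * (χ t * deriv f t) - deriv χ t * f t) ^ 2 := by positivity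
      linarith
    have e2 : (χ t * deriv f t) ^ 2 ≤ deriv f t ^ 2 := by
      rw [mul_pow]; exact mul_le_of_le_one_left (sq_nonneg _) (hχ1 t)
    have e3 : (deriv χ t * f t) ^ 2 ≤ B ^ 2 * f t ^ 2 := by
      rw [mul_pow]; exact mul_le_mul_of_nonneg_right (hB2 t) (sq_nonneg _)
    have e4 : (1 + ε⁻¹) = (1 + ε) * ε⁻¹ := by field_simp; ring
    have e5 := mul_le_mul_of_nonneg_left e2 (by positivity : 0 ≤ 1 + ε)
    have e6 := mul_le_mul_of_nonneg_left e3 (by positivity : 0 ≤ 1 + ε⁻¹)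
    have e7 : (1 + ε⁻¹) * (B ^ 2 * f t ^ 2) = (1 + ε) * (ε⁻¹ * B ^ 2 * f t ^ 2) := by
      rw [e4]; ring
    have e8 := mul_nonneg hε0.le hV
    simp only [hgd]
    linarith
  have main := (oscillatorEnergy_mul_le_scaled hp a hgs hgc).trans step
  rw [integral_const_mul] at main
  have hI0 : 0 ≤ ∫ t, (χ t * f t) ^ 2 := integral_nonneg fun t => sq_nonneg _
  have low := mul_le_mul_of_nonneg_right hεlam (mul_nonneg hA0 hI0)
  have fin : lam * A * ∫ t, (χ t * f t) ^ 2 ≤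
      ∫ t, (deriv f t ^ 2 + (ε⁻¹ * B ^ 2 + |a * t| ^ p * χ t ^ 2) * f t ^ 2) := by
    refine le_of_mul_le_mul_left ?_ (by positivity : 0 < 1 + ε)
    linarith
  rw [← integral_const_mul] at fin
  rw [← sub_nonneg, ← integral_sub i6 (i2.const_mul _)] at fin
  refine fin.trans_eq (integral_congr_ae (Filter.Eventually.of_forall fun t => ?_))
  ring

/-- Away from the strip `|y| ≤ M` the potential `|xy|^p` dominates, inside it the effective
transversal energy does. -/
lemma potential_lower_bound_of_large {p lam M s x y : ℝ} (hp : 1 ≤ p) (hlam0 : 0 ≤ lam)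
    (hM : M = 1 + 2 * lam) (hs0 : 0 ≤ s) (hs1 : s ≤ 1) (hin : |y| ≤ M → s = 1)
    (hout : 2 * M ≤ |y| → s = 0) (hx : 2 * M ≤ |x|) :
    -(lam * ((2 * M) ^ 2) ^ (p / (p + 2))) ≤ lam * (x ^ 2) ^ (p / (p + 2)) * s +
      |x * y| ^ p * (1 - s) - lam * (x ^ 2 + y ^ 2) ^ (p / (p + 2)) := by
  have hq0 : 0 < p / (p + 2) := by positivity
  have hq1 : p / (p + 2) ≤ 1 := by rw [div_le_one (by linarith)]; linarith
  have hq2 : 2 * (p / (p + 2)) ≤ p := by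
    rw [← mul_div_assoc, div_le_iff₀ (by linarith)]; nlinarith
  have hsub := rpow_add_le_add_rpow (sq_nonneg x) (sq_nonneg y) hq0.le hq1
  set q := p / (p + 2)
  have hlamsub := mul_le_mul_of_nonneg_left hsub hlam0
  have hc0 : 0 ≤ lam * ((2 * M) ^ 2) ^ q := by positivity
  have inner : |y| ≤ 2 * M → lam * (y ^ 2) ^ q ≤ lam * ((2 * M) ^ 2) ^ q := fun h => by
    refine mul_le_mul_of_nonneg_left (rpow_le_rpow (sq_nonneg _) ?_ hq0.le) hlam0
    rw [← sq_abs]; exact pow_le_pow_left₀ (abs_nonneg _) h 2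
  have outer : M ≤ |y| → lam * (x ^ 2) ^ q + lam * (y ^ 2) ^ q ≤ |x * y| ^ p := fun h => by
    have grow : ∀ z : ℝ, 1 ≤ |z| → (z ^ 2) ^ q ≤ |z| ^ p := fun z hz => by
      rw [← sq_abs, ← rpow_natCast, ← rpow_mul (abs_nonneg _)]
      exact rpow_le_rpow_of_exponent_le hz (by exact_mod_cast hq2)
    have large : ∀ z : ℝ, M ≤ |z| → 2 * lam ≤ |z| ^ p := fun z hz => by
      have := rpow_le_rpow_of_exponent_le (by linarith : 1 ≤ |z|) hp
      rw [rpow_one] at this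
      linarith
    have gx := grow x (by linarith)
    have gy := grow y (by linarith)
    have lx := large x (by linarith)
    have ly := large y h
    have hx0 : 0 ≤ |x| ^ p := by positivity
    have hy0 : 0 ≤ |y| ^ p := by positivity
    rw [abs_mul, mul_rpow (abs_nonneg _) (abs_nonneg _)]
    nlinarith [mul_le_mul_of_nonneg_left gx hlam0, mul_le_mul_of_nonneg_left gy hlam0,
      mul_le_mul_of_nonneg_left ly hx0, mul_le_mul_of_nonneg_right lx hy0]
  rcases le_total |y| M with h | h
  · rw [hin h]
    linarith [inner (by linarith [abs_nonneg y])]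
  have o := outer h
  rcases le_total (2 * M) |y| with h2 | h2
  · rw [hout h2]
    linarith
  · have i := inner h2
    have hy : 0 ≤ lam * (y ^ 2) ^ q := by positivity
    nlinarith [mul_le_mul_of_nonneg_right o (sub_nonneg.2 hs1),
      mul_le_mul_of_nonneg_right i hs0, mul_le_mul_of_nonneg_left hs1 hc0]

/-- The effective potential obtained after localizing in both coordinate strips is bounded
below. -/
lemma exists_effective_potential_lower_bound {p lam M : ℝ} (hp : 1 ≤ p) (hlam0 : 0 ≤ lam)
    (hM : M = 1 + 2 * lam) {s : ℝ → ℝ} (hs0 : ∀ t, 0 ≤ s t) (hs1 : ∀ t, s t ≤ 1)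
    (hin : ∀ t, |t| ≤ M → s t = 1) (hout : ∀ t, 2 * M ≤ |t| → s t = 0) :
    ∃ C : ℝ, ∀ x y : ℝ, C ≤ lam * (x ^ 2) ^ (p / (p + 2)) * s y +
      lam * (y ^ 2) ^ (p / (p + 2)) * s x + |x * y| ^ p * (1 - s x - s y) -
      lam * (x ^ 2 + y ^ 2) ^ (p / (p + 2)) := by
  have hq0 : 0 < p / (p + 2) := by positivity
  set q := p / (p + 2) with hq
  have hc0 : 0 ≤ lam * ((2 * M) ^ 2) ^ q := by positivity
  have hd0 : 0 ≤ ((2 * M) * (2 * M)) ^ p := rpow_nonneg (mul_self_nonneg _) _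
  have he0 : 0 ≤ lam * ((2 * M) ^ 2 + (2 * M) ^ 2) ^ q := by positivity
  refine ⟨-(lam * ((2 * M) ^ 2) ^ q + ((2 * M) * (2 * M)) ^ p +
    lam * ((2 * M) ^ 2 + (2 * M) ^ 2) ^ q), fun x y => ?_⟩
  rcases le_total (2 * M) |x| with hx | hx
  · have := potential_lower_bound_of_large hp hlam0 hM (hs0 y) (hs1 y) (hin y) (hout y) hx
    rw [← hq] at this
    rw [hout x hx]
    linarith
  rcases le_total (2 * M) |y| with hy | hy
  · have := potential_lower_bound_of_large hp hlam0 hM (hs0 x) (hs1 x) (hin x) (hout x) hy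
    rw [← hq, mul_comm y x, add_comm (y ^ 2)] at this
    rw [hout y hy]
    linarith
  have b1 : |x * y| ^ p ≤ ((2 * M) * (2 * M)) ^ p := by
    rw [abs_mul]
    exact rpow_le_rpow (by positivity)
      (mul_le_mul hx hy (abs_nonneg _) (by linarith)) (by linarith)
  have b2 : lam * (x ^ 2 + y ^ 2) ^ q ≤ lam * ((2 * M) ^ 2 + (2 * M) ^ 2) ^ q := by
    refine mul_le_mul_of_nonneg_left (rpow_le_rpow (by positivity) ?_ hq0.le) hlam0
    rw [← sq_abs x, ← sq_abs y]
    exact add_le_add (pow_le_pow_left₀ (abs_nonneg _) hx 2)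
      (pow_le_pow_left₀ (abs_nonneg _) hy 2)
  have n1 : 0 ≤ lam * (x ^ 2) ^ q * s y := mul_nonneg (by positivity) (hs0 y)
  have n2 : 0 ≤ lam * (y ^ 2) ^ q * s x := mul_nonneg (by positivity) (hs0 x)
  have n3 : 0 ≤ |x * y| ^ p := by positivity
  have n4 : -|x * y| ^ p ≤ |x * y| ^ p * (1 - s x - s y) := by
    nlinarith [mul_le_mul_of_nonneg_left (add_le_add (hs1 x) (hs1 y)) n3]
  linarith

/-- If `0 ≤ λ < γ_p`, the quadratic form of `L_p(λ)` is bounded from below. -/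
theorem subcritical_bounded_below (p : ℝ) (hp : 1 ≤ p) (lam : ℝ) (hlam0 : 0 ≤ lam)
    (hlam : lam < sInf {E : ℝ | ∃ u : ℝ → ℝ, ContDiff ℝ (⊤ : ℕ∞) u ∧ HasCompactSupport u ∧
        (∫ t : ℝ, (u t) ^ 2) = 1 ∧
        E = ∫ t : ℝ, ((deriv u t) ^ 2 + |t| ^ p * (u t) ^ 2)}) :
    ∃ C : ℝ, ∀ ψ : ℝ × ℝ → ℝ, ContDiff ℝ (⊤ : ℕ∞) ψ → HasCompactSupport ψ →
      (∫ v : ℝ × ℝ, (ψ v) ^ 2) = 1 →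
      (∫ v : ℝ × ℝ, ((fderiv ℝ ψ v (1, 0)) ^ 2 + (fderiv ℝ ψ v (0, 1)) ^ 2 +
        (|v.1 * v.2| ^ p - lam * (v.1 ^ 2 + v.2 ^ 2) ^ (p / (p + 2))) * (ψ v) ^ 2)) ≥ C := by
  have hp0 : 0 < p := by linarith
  have hq0 : 0 < p / (p + 2) := by positivity
  obtain ⟨M, hM⟩ : ∃ M, M = 1 + 2 * lam := ⟨_, rfl⟩
  let χ : ContDiffBump (0 : ℝ) := ⟨M, 2 * M, by linarith, by linarith⟩
  have hχ : ContDiff ℝ (⊤ : ℕ∞) χ := χ.contDiff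
  have hχc : Continuous χ := χ.continuous
  have hs1 : ∀ t, χ t ^ 2 ≤ 1 := fun t => pow_le_one₀ χ.nonneg χ.le_one
  obtain ⟨K, hK⟩ := exists_localized_oscillator_bound hp0 hlam0 hlam hχ χ.hasCompactSupport hs1
  obtain ⟨C, hC⟩ := exists_effective_potential_lower_bound (s := fun t => χ t ^ 2) hp hlam0 hM
    (fun t => sq_nonneg _) hs1
    (fun t ht => by
      rw [χ.one_of_mem_closedBall (by simpa using ht), one_pow])
    (fun t ht => by
      rw [χ.zero_of_le_dist (by simpa using ht), zero_pow two_ne_zero])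
  refine ⟨C - 2 * K, fun ψ hψ hc hn => ?_⟩
  have hψc := hψ.continuous
  have hψd : Differentiable ℝ ψ := hψ.differentiable (by simp)
  have hfd : ∀ e : ℝ × ℝ, Continuous fun v => fderiv ℝ ψ v e := fun e =>
    (hψ.continuous_fderiv (by simp)).clm_apply continuous_const
  have hfc : ∀ e : ℝ × ℝ, HasCompactSupport fun v => fderiv ℝ ψ v e := fun e =>
    hc.fderiv_apply ℝ e
  have iD : ∀ e : ℝ × ℝ, Integrable fun v => fderiv ℝ ψ v e ^ 2 := fun e =>
    integrable_sq_of_hasCompactSupport (hfd e) (hfc e)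
  have iψ : Integrable fun v => ψ v ^ 2 := integrable_sq_of_hasCompactSupport hψc hc
  have cV : Continuous fun v : ℝ × ℝ => |v.1 * v.2| ^ p :=
    (by fun_prop : Continuous fun v : ℝ × ℝ => |v.1 * v.2|).rpow_const fun _ => Or.inr hp0.le
  have cR : Continuous fun v : ℝ × ℝ => (v.1 ^ 2 + v.2 ^ 2) ^ (p / (p + 2)) :=
    (by fun_prop : Continuous fun v : ℝ × ℝ => v.1 ^ 2 + v.2 ^ 2).rpow_const
      fun _ => Or.inr hq0.le
  have c1 : Continuous fun v : ℝ × ℝ => (v.1 ^ 2) ^ (p / (p + 2)) :=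
    (by fun_prop : Continuous fun v : ℝ × ℝ => v.1 ^ 2).rpow_const fun _ => Or.inr hq0.le
  have c2 : Continuous fun v : ℝ × ℝ => (v.2 ^ 2) ^ (p / (p + 2)) :=
    (by fun_prop : Continuous fun v : ℝ × ℝ => v.2 ^ 2).rpow_const fun _ => Or.inr hq0.le
  have iy : Integrable fun v : ℝ × ℝ => fderiv ℝ ψ v (0, 1) ^ 2 +
      (K + |v.1 * v.2| ^ p * χ v.2 ^ 2 -
        lam * (v.1 ^ 2) ^ (p / (p + 2)) * χ v.2 ^ 2) * ψ v ^ 2 :=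
    (iD _).add (integrable_weight_mul_sq (by fun_prop) hψc hc)
  have ix : Integrable fun v : ℝ × ℝ => fderiv ℝ ψ v (1, 0) ^ 2 +
      (K + |v.2 * v.1| ^ p * χ v.1 ^ 2 -
        lam * (v.2 ^ 2) ^ (p / (p + 2)) * χ v.1 ^ 2) * ψ v ^ 2 := by
    simp_rw [mul_comm (Prod.snd _) (Prod.fst _)]
    exact (iD _).add (integrable_weight_mul_sq (by fun_prop) hψc hc)
  have iE : Integrable fun v : ℝ × ℝ =>
      (fderiv ℝ ψ v (1, 0)) ^ 2 + (fderiv ℝ ψ v (0, 1)) ^ 2 +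
        (|v.1 * v.2| ^ p - lam * (v.1 ^ 2 + v.2 ^ 2) ^ (p / (p + 2))) * (ψ v) ^ 2 :=
    ((iD _).add (iD _)).add (integrable_weight_mul_sq (by fun_prop) hψc hc)
  have boundy : 0 ≤ ∫ v : ℝ × ℝ, (fderiv ℝ ψ v (0, 1) ^ 2 +
      (K + |v.1 * v.2| ^ p * χ v.2 ^ 2 -
        lam * (v.1 ^ 2) ^ (p / (p + 2)) * χ v.2 ^ 2) * ψ v ^ 2) := by
    rw [Measure.volume_eq_prod] at iy ⊢
    rw [integral_prod _ iy]
    refine integral_nonneg fun x => ?_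
    have hd : ∀ t, deriv (fun t => ψ (x, t)) t = fderiv ℝ ψ (x, t) (0, 1) := fun t =>
      ((hψd (x, t)).hasFDerivAt.comp_hasDerivAt t
        ((hasDerivAt_const t x).prodMk (hasDerivAt_id t))).deriv
    have := hK x (fun t => ψ (x, t)) (hψ.comp (contDiff_const.prodMk contDiff_id))
      (hc.comp_isClosedEmbedding (Function.LeftInverse.isClosedEmbedding (f := Prod.snd) (fun _ => rfl)
        continuous_snd (by fun_prop)))
    simp only [hd] at this
    exact this
  have boundx : 0 ≤ ∫ v : ℝ × ℝ, (fderiv ℝ ψ v (1, 0) ^ 2 +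
      (K + |v.2 * v.1| ^ p * χ v.1 ^ 2 -
        lam * (v.2 ^ 2) ^ (p / (p + 2)) * χ v.1 ^ 2) * ψ v ^ 2) := by
    rw [Measure.volume_eq_prod] at ix ⊢
    rw [integral_prod_symm _ ix]
    refine integral_nonneg fun y => ?_
    have hd : ∀ t, deriv (fun t => ψ (t, y)) t = fderiv ℝ ψ (t, y) (1, 0) := fun t =>
      ((hψd (t, y)).hasFDerivAt.comp_hasDerivAt t
        ((hasDerivAt_id t).prodMk (hasDerivAt_const t y))).deriv
    have := hK y (fun t => ψ (t, y)) (hψ.comp (contDiff_id.prodMk contDiff_const))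
      (hc.comp_isClosedEmbedding (Function.LeftInverse.isClosedEmbedding (f := Prod.fst) (fun _ => rfl)
        continuous_fst (by fun_prop)))
    simp only [hd] at this
    exact this
  have mono := integral_mono ((ix.add iy).add (iψ.const_mul (C - 2 * K))) iE fun v => by
    have := mul_le_mul_of_nonneg_right (hC v.1 v.2) (sq_nonneg (ψ v))
    simp only [Pi.add_apply, mul_comm v.2 v.1]
    linarith
  rw [integral_add' (ix.add iy) (iψ.const_mul _), integral_add' ix iy, integral_const_mul, hn] at mono
  linarith
end

section
/- Let p ≥ 1, let α := (5+√105)²/40 and c := 2(α²/5 + 1). Then for every real-valued ψ ∈ C_c^∞(ℝ²) with ∫_{ℝ²} ψ(x,y)² dx dy = 1 one has ∫_{ℝ²} (x²+y²)^{p/(p+2)} ψ(x,y)² dx dy ≤ α ( ∫_{ℝ²} |∇ψ(x,y)|² dx dy + ∫_{ℝ²} |xy|^p ψ(x,y)² dx dy ) + c. -/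
open MeasureTheory Real

/-- The Riccati subsolution `u(t) = 32 t / (5 (16 + t²))` for the potential `|t|^p / 2`. -/
theorem riccati_subsolution {p : ℝ} (hp : 1 ≤ p) (t : ℝ) :
    (32 * t / (5 * (16 + t ^ 2))) ^ 2 + 9 / 50 ≤
      32 * (16 - t ^ 2) / (5 * (16 + t ^ 2) ^ 2) + |t| ^ p / 2 := by
  have hd : 0 < 16 + t ^ 2 := by positivity
  suffices h : 0 ≤ 32 * (16 - t ^ 2) / 5 - 1024 * t ^ 2 / 25
      + (|t| ^ p / 2 - 9 / 50) * (16 + t ^ 2) ^ 2 by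
    rw [← sub_nonneg]
    have e : 32 * (16 - t ^ 2) / (5 * (16 + t ^ 2) ^ 2) + |t| ^ p / 2
        - ((32 * t / (5 * (16 + t ^ 2))) ^ 2 + 9 / 50)
        = (32 * (16 - t ^ 2) / 5 - 1024 * t ^ 2 / 25
          + (|t| ^ p / 2 - 9 / 50) * (16 + t ^ 2) ^ 2) / (16 + t ^ 2) ^ 2 := by
      field_simp
      ring
    rw [e]
    positivity
  rw [← sq_abs t]
  have ha := abs_nonneg t
  generalize |t| = a at ha ⊢
  rcases le_total a 1 with h1 | h1
  · have hp0 : 0 ≤ a ^ p := rpow_nonneg ha p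
    have hu : a ^ 2 ≤ 1 := pow_le_one₀ ha h1
    nlinarith [mul_nonneg hp0 (sq_nonneg (16 + a ^ 2)), sq_nonneg a,
      mul_nonneg (sq_nonneg a) (sub_nonneg.2 hu)]
  · have hpa : a ≤ a ^ p := by simpa using rpow_le_rpow_of_exponent_le h1 hp
    have h2 : (8 / 25 * a) * (256 + 32 * a ^ 2) ≤ (a ^ p / 2 - 9 / 50) * (16 + a ^ 2) ^ 2 := by
      apply mul_le_mul <;> nlinarith [sq_nonneg (a ^ 2)]
    nlinarith [mul_nonneg ha (sq_nonneg (a - 2)), mul_nonneg ha (sq_nonneg (a - 3))]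

theorem hasDerivAt_riccati_scaled (s y : ℝ) :
    HasDerivAt (fun y : ℝ ↦ s * (32 * (s * y) / (5 * (16 + (s * y) ^ 2))))
      (s ^ 2 * (32 * (16 - (s * y) ^ 2) / (5 * (16 + (s * y) ^ 2) ^ 2))) y := by
  have hd : 16 + (s * y) ^ 2 ≠ 0 := by positivity
  have h1 : HasDerivAt (fun y : ℝ ↦ s * y) s y := by simpa using (hasDerivAt_id y).const_mul s
  have h2 := ((h1.const_mul 32).div (((h1.pow 2).const_add 16).const_mul 5)
    (by positivity)).const_mul s
  refine h2.congr_deriv ?_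
  simp only [Pi.pow_apply]
  field_simp
  ring

theorem HasCompactSupport.pow_two {X : Type*} [TopologicalSpace X] {f : X → ℝ}
    (hf : HasCompactSupport f) : HasCompactSupport fun x ↦ f x ^ 2 :=
  hf.comp_left (g := fun z : ℝ ↦ z ^ 2) (by simp)

/-- Lower bound for the anharmonic oscillator `-d²/dy² + s² |s y|^p / 2` on the line. -/
theorem anharmonic_oscillator_bound {p : ℝ} (hp : 1 ≤ p) (s : ℝ) {f f' : ℝ → ℝ}
    (hf : Continuous f) (hf' : Continuous f') (hd : ∀ y, HasDerivAt f (f' y) y)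
    (hs : HasCompactSupport f) (hs' : HasCompactSupport f') :
    ∫ y, 9 / 50 * s ^ 2 * f y ^ 2 ≤ ∫ y, (f' y ^ 2 + s ^ 2 * |s * y| ^ p / 2 * f y ^ 2) := by
  have hp0 : 0 ≤ p := by linarith
  set w : ℝ → ℝ := fun y ↦ s * (32 * (s * y) / (5 * (16 + (s * y) ^ 2))) with hw
  set w' : ℝ → ℝ := fun y ↦ s ^ 2 * (32 * (16 - (s * y) ^ 2) / (5 * (16 + (s * y) ^ 2) ^ 2))
    with hw'
  have hwd : ∀ y, HasDerivAt w (w' y) y := hasDerivAt_riccati_scaled s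
  have hwc : Continuous w := continuous_iff_continuousAt.2 fun y ↦ (hwd y).continuousAt
  have hwc' : Continuous w' := by
    have : ∀ y : ℝ, 5 * (16 + (s * y) ^ 2) ^ 2 ≠ 0 := fun y ↦ by positivity
    fun_prop (disch := assumption)
  have hs2 : HasCompactSupport fun y ↦ f y ^ 2 := hs.pow_two
  have hs2' : HasCompactSupport fun y ↦ f' y ^ 2 := hs'.pow_two
  have hpot : Continuous fun y : ℝ ↦ s ^ 2 * |s * y| ^ p / 2 := by
    fun_prop (disch := assumption)
  have hF : ∀ y, HasDerivAt (fun y ↦ w y * f y ^ 2)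
      (w' y * f y ^ 2 + w y * (2 * f y * f' y)) y := fun y ↦ by
    refine ((hwd y).mul ((hd y).pow 2)).congr_deriv ?_
    simp
  have hFi : Integrable fun y ↦ w y * f y ^ 2 :=
    (hwc.mul (hf.pow 2)).integrable_of_hasCompactSupport hs2.mul_left
  have hFi' : Integrable fun y ↦ w' y * f y ^ 2 + w y * (2 * f y * f' y) := by
    refine Continuous.integrable_of_hasCompactSupport (by fun_prop) ?_
    exact hs2.mul_left.add hs'.mul_left.mul_left
  have hG : Integrable fun y ↦ f' y ^ 2 + s ^ 2 * |s * y| ^ p / 2 * f y ^ 2 :=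
    ((hf'.pow 2).add (hpot.mul (hf.pow 2))).integrable_of_hasCompactSupport
      (hs2'.add hs2.mul_left)
  have h0 := integral_eq_zero_of_hasDerivAt_of_integrable hF hFi' hFi
  rw [← add_zero (∫ y, (f' y ^ 2 + _)), ← h0, ← integral_add hG hFi']
  refine integral_mono
    ((continuous_const.mul (hf.pow 2)).integrable_of_hasCompactSupport hs2.mul_left)
    (hG.add hFi') fun y ↦ ?_
  have hric := mul_le_mul_of_nonneg_left (riccati_subsolution hp (s * y))
    (mul_nonneg (sq_nonneg s) (sq_nonneg (f y)))
  simp only [hw, hw']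
  nlinarith [sq_nonneg (f' y + w y * f y)]

theorem HasCompactSupport.comp_prodMk {X Y M : Type*} [TopologicalSpace X] [TopologicalSpace Y]
    [T2Space Y] [Zero M] {f : X × Y → M} (hf : HasCompactSupport f) (x : X) :
    HasCompactSupport fun y ↦ f (x, y) := by
  refine HasCompactSupport.intro (IsCompact.image hf continuous_snd) fun y hy ↦ ?_
  by_contra h
  exact hy ⟨(x, y), subset_tsupport f h, rfl⟩

theorem rpow_scaling {p : ℝ} (hp : 1 ≤ p) (x y : ℝ) :
    (|x| ^ (p / (p + 2))) ^ 2 * |(|x| ^ (p / (p + 2))) * y| ^ p = |x * y| ^ p := by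
  have hs : 0 ≤ |x| ^ (p / (p + 2)) := by positivity
  have h2 : p / (p + 2) * 2 + p / (p + 2) * p = p := by field_simp; ring
  rw [abs_mul, abs_mul, abs_of_nonneg hs, mul_rpow hs (abs_nonneg y),
    mul_rpow (abs_nonneg x) (abs_nonneg y), ← mul_assoc, ← rpow_natCast, ← rpow_mul (abs_nonneg x),
    ← rpow_mul (abs_nonneg x), ← rpow_add_of_nonneg (abs_nonneg x) (by positivity) (by positivity)]
  push_cast
  rw [h2]

/-- Transverse confinement in the `y` direction, integrated over `x`. -/
theorem transverse_bound {p : ℝ} (hp : 1 ≤ p) {f f' : ℝ × ℝ → ℝ}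
    (hf : Continuous f) (hf' : Continuous f')
    (hd : ∀ x y, HasDerivAt (fun y ↦ f (x, y)) (f' (x, y)) y)
    (hs : HasCompactSupport f) (hs' : HasCompactSupport f') :
    9 / 50 * ∫ v : ℝ × ℝ, (v.1 ^ 2) ^ (p / (p + 2)) * f v ^ 2 ≤
      (∫ v, f' v ^ 2) + (∫ v : ℝ × ℝ, |v.1 * v.2| ^ p * f v ^ 2) / 2 := by
  have hp0 : 0 ≤ p := by linarith
  have hσ : 0 ≤ p / (p + 2) := by positivity
  have hs2 : HasCompactSupport fun v ↦ f v ^ 2 := hs.pow_two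
  have hs2' : HasCompactSupport fun v ↦ f' v ^ 2 := hs'.pow_two
  have hi1 : Integrable fun v : ℝ × ℝ ↦ (v.1 ^ 2) ^ (p / (p + 2)) * f v ^ 2 :=
    Continuous.integrable_of_hasCompactSupport (by fun_prop (disch := assumption)) hs2.mul_left
  have hi2 : Integrable fun v ↦ f' v ^ 2 := (hf'.pow 2).integrable_of_hasCompactSupport hs2'
  have hi3 : Integrable fun v : ℝ × ℝ ↦ |v.1 * v.2| ^ p * f v ^ 2 :=
    Continuous.integrable_of_hasCompactSupport (by fun_prop (disch := assumption)) hs2.mul_left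
  have hi4 : Integrable fun v : ℝ × ℝ ↦ f' v ^ 2 + |v.1 * v.2| ^ p * f v ^ 2 / 2 :=
    hi2.add (hi3.div_const 2)
  rw [← integral_const_mul, ← integral_div, ← integral_add hi2 (hi3.div_const 2),
    Measure.volume_eq_prod, integral_prod _ (hi1.const_mul _), integral_prod _ hi4]
  refine integral_mono (hi1.const_mul _).integral_prod_left hi4.integral_prod_left fun x ↦ ?_
  convert anharmonic_oscillator_bound hp (|x| ^ (p / (p + 2)))
    (hf.comp (Continuous.prodMk_right x)) (hf'.comp (Continuous.prodMk_right x)) (hd x)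
    (hs.comp_prodMk x) (hs'.comp_prodMk x) using 3 with y y
  · rfl
  · have hx : (x ^ 2) ^ (p / (p + 2)) = (|x| ^ (p / (p + 2))) ^ 2 := by
      rw [← sq_abs, rpow_pow_comm (abs_nonneg x)]
    simp only [Function.comp_apply, hx, mul_assoc]
  · simp only [Function.comp_apply, rpow_scaling hp]
    ring

/-- the key bound
`∫ (x²+y²)^{p/(p+2)} ψ² ≤ α (∫ |∇ψ|² + ∫ |xy|^p ψ²) + c` for normalized `ψ ∈ C_c^∞(ℝ²)`. -/
theorem potential_bound (p : ℝ) (hp : 1 ≤ p)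
    (α c : ℝ) (hα : α = (5 + Real.sqrt 105) ^ 2 / 40) (hc : c = 2 * (α ^ 2 / 5 + 1))
    (ψ : ℝ × ℝ → ℝ) (hψ : ContDiff ℝ (⊤ : ℕ∞) ψ) (hsupp : HasCompactSupport ψ)
    (hnorm : (∫ v : ℝ × ℝ, (ψ v) ^ 2) = 1) :
    (∫ v : ℝ × ℝ, (v.1 ^ 2 + v.2 ^ 2) ^ (p / (p + 2)) * (ψ v) ^ 2) ≤
      α * ((∫ v : ℝ × ℝ, ((fderiv ℝ ψ v (1, 0)) ^ 2 + (fderiv ℝ ψ v (0, 1)) ^ 2)) +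
        (∫ v : ℝ × ℝ, |v.1 * v.2| ^ p * (ψ v) ^ 2)) + c := by
  have hp0 : 0 ≤ p := by linarith
  have hσ : 0 ≤ p / (p + 2) := by positivity
  have hσ1 : p / (p + 2) ≤ 1 := by rw [div_le_one (by linarith)]; linarith
  have hψc := hψ.continuous
  have hdiff : Differentiable ℝ ψ := hψ.differentiable (by simp)
  have hDc (e : ℝ × ℝ) : Continuous fun v ↦ fderiv ℝ ψ v e :=
    (hψ.continuous_fderiv (by simp)).clm_apply continuous_const
  have hDs (e : ℝ × ℝ) : HasCompactSupport fun v ↦ fderiv ℝ ψ v e := hsupp.fderiv_apply ℝ e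
  have hs2 : HasCompactSupport fun v ↦ ψ v ^ 2 := hsupp.pow_two
  have hD2 (e : ℝ × ℝ) : Integrable fun v ↦ fderiv ℝ ψ v e ^ 2 :=
    ((hDc e).pow 2).integrable_of_hasCompactSupport
      (hDs e).pow_two
  have hy := transverse_bound hp hψc (hDc (0, 1)) (fun x y ↦
    (hdiff (x, y)).hasFDerivAt.comp_hasDerivAt y
      ((hasDerivAt_const y x).prodMk (hasDerivAt_id y))) hsupp (hDs (0, 1))
  have hx := transverse_bound hp (hψc.comp continuous_swap) ((hDc (1, 0)).comp continuous_swap)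
    (fun x y ↦
      (hdiff (y, x)).hasFDerivAt.comp_hasDerivAt y
        ((hasDerivAt_id y).prodMk (hasDerivAt_const y x)))
    (hsupp.comp_homeomorph (Homeomorph.prodComm ℝ ℝ))
    ((hDs (1, 0)).comp_homeomorph (Homeomorph.prodComm ℝ ℝ))
  have hswap (g : ℝ × ℝ → ℝ) : ∫ v : ℝ × ℝ, g v.swap = ∫ v, g v := by
    rw [Measure.volume_eq_prod]; exact integral_prod_swap g
  rw [← hswap, ← hswap fun v ↦ ((fun v ↦ fderiv ℝ ψ v (1, 0)) ∘ Prod.swap) v ^ 2,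
    ← hswap fun v ↦ |v.1 * v.2| ^ p * (ψ ∘ Prod.swap) v ^ 2] at hx
  simp only [Function.comp_apply, Prod.swap_swap, Prod.fst_swap, Prod.snd_swap] at hx
  simp only [mul_comm (Prod.snd _)] at hx
  have hi1 : Integrable fun v : ℝ × ℝ ↦ (v.1 ^ 2) ^ (p / (p + 2)) * ψ v ^ 2 :=
    Continuous.integrable_of_hasCompactSupport (by fun_prop (disch := assumption)) hs2.mul_left
  have hi2 : Integrable fun v : ℝ × ℝ ↦ (v.2 ^ 2) ^ (p / (p + 2)) * ψ v ^ 2 :=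
    Continuous.integrable_of_hasCompactSupport (by fun_prop (disch := assumption)) hs2.mul_left
  have hi : Integrable fun v : ℝ × ℝ ↦ (v.1 ^ 2 + v.2 ^ 2) ^ (p / (p + 2)) * ψ v ^ 2 :=
    Continuous.integrable_of_hasCompactSupport (by fun_prop (disch := assumption)) hs2.mul_left
  have hsub := integral_mono hi (hi1.add hi2) fun v ↦ by
    simp only [Pi.add_apply, ← add_mul]
    exact mul_le_mul_of_nonneg_right
      (rpow_add_le_add_rpow (sq_nonneg v.1) (sq_nonneg v.2) hσ hσ1) (sq_nonneg _)
  rw [integral_add' hi1 hi2] at hsub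
  rw [integral_add (hD2 _) (hD2 _)]
  have hE : 0 ≤ (∫ v, fderiv ℝ ψ v (1, 0) ^ 2) + (∫ v, fderiv ℝ ψ v (0, 1) ^ 2)
      + ∫ v : ℝ × ℝ, |v.1 * v.2| ^ p * ψ v ^ 2 := by positivity
  have hα' : 50 / 9 ≤ α := by
    have : (10 : ℝ) ≤ √105 := le_sqrt_of_sq_le (by norm_num)
    rw [hα]
    nlinarith
  have hc' : 0 ≤ c := by rw [hc]; positivity
  linarith [mul_le_mul_of_nonneg_right hα' hE]
end

section
/- Let p ≥ 1 and δ > 0. Then for every real-valued ψ ∈ C_c^∞(ℝ²) one has ∫_1^∞ ∫_0^{(1+δ) y^{−p/(p+2)}} y^{2p/(p+2)} ψ(x,y)² dx dy ≤ (5/2)(1+δ)² ∫_1^∞ ∫_0^∞ (∂ψ/∂x)(x,y)² dx dy + 2((1+δ)/δ) ∫_1^∞ ∫_0^{(1+δ) y^{−p/(p+2)}} x^p y^p ψ(x,y)² dx dy. -/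
open MeasureTheory Real Set

/-- Cauchy–Schwarz for the integral of a continuous function against the constant `1`. -/
theorem sq_intervalIntegral_le {g : ℝ → ℝ} (hg : Continuous g) {s t : ℝ} (hst : s ≤ t) :
    (∫ x in s..t, g x) ^ 2 ≤ (t - s) * ∫ x in s..t, g x ^ 2 := by
  rcases hst.eq_or_lt with rfl | hlt
  · simp
  set c := ∫ x in s..t, g x
  set K := ∫ x in s..t, g x ^ 2
  have hnonneg : 0 ≤ ∫ x in s..t, ((t - s) * g x - c) ^ 2 :=
    intervalIntegral.integral_nonneg hst fun _ _ => sq_nonneg _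
  have hexpand : ∫ x in s..t, ((t - s) * g x - c) ^ 2
      = (t - s) ^ 2 * K - 2 * (t - s) * c * c + (t - s) * c ^ 2 := by
    have hfun : (fun x => ((t - s) * g x - c) ^ 2)
        = fun x => (t - s) ^ 2 * g x ^ 2 - 2 * (t - s) * c * g x + c ^ 2 := by
      funext x; ring
    rw [hfun, intervalIntegral.integral_add, intervalIntegral.integral_sub,
      intervalIntegral.integral_const_mul, intervalIntegral.integral_const_mul,
      intervalIntegral.integral_const, smul_eq_mul]
    all_goals exact Continuous.intervalIntegrable (by fun_prop) _ _
  rw [hexpand] at hnonneg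
  have hpos : 0 < t - s := sub_pos.2 hlt
  refine le_of_mul_le_mul_left ?_ hpos
  nlinarith

theorem sq_sub_le_mul_integral_sq_deriv {f g : ℝ → ℝ} (hf : ∀ x, HasDerivAt f (g x) x)
    (hg : Continuous g) {b s t : ℝ} (hs : s ∈ Icc 0 b) (ht : t ∈ Icc 0 b) :
    (f s - f t) ^ 2 ≤ b * ∫ x in (0 : ℝ)..b, g x ^ 2 := by
  wlog hst : s ≤ t generalizing s t
  · rw [← neg_sub, neg_sq]
    exact this ht hs (le_of_not_ge hst)
  have hftc : ∫ x in s..t, g x = f t - f s :=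
    intervalIntegral.integral_eq_sub_of_hasDerivAt (fun x _ => hf x) (hg.intervalIntegrable _ _)
  have hmono : ∫ x in s..t, g x ^ 2 ≤ ∫ x in (0 : ℝ)..b, g x ^ 2 :=
    intervalIntegral.integral_mono_interval hs.1 hst ht.2
      (Filter.Eventually.of_forall fun x => sq_nonneg (g x))
      (Continuous.intervalIntegrable (by fun_prop) _ _)
  have hnonneg : 0 ≤ ∫ x in s..t, g x ^ 2 :=
    intervalIntegral.integral_nonneg hst fun _ _ => sq_nonneg _
  calc (f s - f t) ^ 2 = (∫ x in s..t, g x) ^ 2 := by rw [hftc]; ring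
    _ ≤ (t - s) * ∫ x in s..t, g x ^ 2 := sq_intervalIntegral_le hg hst
    _ ≤ b * ∫ x in (0 : ℝ)..b, g x ^ 2 :=
      mul_le_mul (by linarith [hs.1, ht.2]) hmono hnonneg (by linarith [hs.1, ht.2])

/-- The mass of `f` on `[0, b]` is controlled by its mass on `[a, b]` and its Dirichlet energy. -/
theorem integral_sq_le_of_hasDerivAt {f g : ℝ → ℝ} (hf : ∀ x, HasDerivAt f (g x) x)
    (hg : Continuous g) {a b : ℝ} (ha : 0 ≤ a) (hab : a ≤ b) :
    (b - a) * ∫ x in (0 : ℝ)..b, f x ^ 2 ≤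
      2 * b * (∫ x in a..b, f x ^ 2) + 2 * b ^ 2 * (b - a) * ∫ x in (0 : ℝ)..b, g x ^ 2 := by
  have hfc : Continuous f := continuous_iff_continuousAt.2 fun x => (hf x).continuousAt
  set K := ∫ x in (0 : ℝ)..b, g x ^ 2
  have hpt : ∀ s ∈ Icc 0 b, ∀ t ∈ Icc a b, f s ^ 2 ≤ 2 * f t ^ 2 + 2 * b * K := by
    intro s hs t ht
    have := sq_sub_le_mul_integral_sq_deriv hf hg hs ⟨ha.trans ht.1, ht.2⟩
    nlinarith [sq_nonneg (f s - 2 * f t)]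
  have hleft : ∀ t ∈ Icc a b, ∫ x in (0 : ℝ)..b, f x ^ 2 ≤ b * (2 * f t ^ 2 + 2 * b * K) := by
    intro t ht
    have h := intervalIntegral.integral_mono_on (ha.trans hab)
      (Continuous.intervalIntegrable (by fun_prop) _ _)
      (intervalIntegrable_const (μ := volume)) fun s hs => hpt s hs t ht
    rwa [intervalIntegral.integral_const, sub_zero, smul_eq_mul] at h
  have h := intervalIntegral.integral_mono_on hab (intervalIntegrable_const (μ := volume))
    (Continuous.intervalIntegrable (by fun_prop) _ _) hleft
  rw [intervalIntegral.integral_const, intervalIntegral.integral_const_mul,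
    intervalIntegral.integral_add (Continuous.intervalIntegrable (by fun_prop) _ _)
      intervalIntegrable_const,
    intervalIntegral.integral_const_mul, intervalIntegral.integral_const, smul_eq_mul,
    smul_eq_mul] at h
  linarith

theorem setIntegral_valley_slice_le {p δ y : ℝ} (hp : 0 ≤ p) (hδ : 0 < δ) (hy : 0 < y)
    {f g : ℝ → ℝ} (hf : ∀ x, HasDerivAt f (g x) x) (hg : Continuous g)
    (hgint : IntegrableOn (fun x => g x ^ 2) (Ioi 0)) :
    (∫ x in Ioo (0 : ℝ) ((1 + δ) * y ^ (-(p / (p + 2)))), y ^ (2 * p / (p + 2)) * f x ^ 2) ≤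
      (5 / 2) * (1 + δ) ^ 2 * (∫ x in Ioi (0 : ℝ), g x ^ 2) +
      2 * ((1 + δ) / δ) *
        ∫ x in Ioo (0 : ℝ) ((1 + δ) * y ^ (-(p / (p + 2)))), x ^ p * y ^ p * f x ^ 2 := by
  have hfc : Continuous f := continuous_iff_continuousAt.2 fun x => (hf x).continuousAt
  set a := y ^ (-(p / (p + 2))) with ha_def
  set w := y ^ (2 * p / (p + 2)) with hw_def
  have ha : 0 < a := rpow_pos_of_pos hy _
  have hw : 0 < w := rpow_pos_of_pos hy _
  have haw : a ^ 2 * w = 1 := by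
    rw [ha_def, hw_def, ← rpow_natCast, ← rpow_mul hy.le, ← rpow_add hy]
    convert rpow_zero y using 2
    push_cast
    ring
  have hpw : a ^ p * y ^ p = w := by
    rw [ha_def, hw_def, ← rpow_mul hy.le, ← rpow_add hy]
    congr 1
    field_simp
    ring
  set b := (1 + δ) * a with hb_def
  have hab : a ≤ b := by nlinarith
  have hb : 0 ≤ b := ha.le.trans hab
  have hIoo : ∀ h : ℝ → ℝ, ∫ x in Ioo 0 b, h x = ∫ x in (0 : ℝ)..b, h x := fun h => by
    rw [intervalIntegral.integral_of_le hb, integral_Ioc_eq_integral_Ioo]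
  rw [hIoo, hIoo, intervalIntegral.integral_const_mul]
  have hmain := integral_sq_le_of_hasDerivAt hf hg ha.le hab
  set I := ∫ x in (0 : ℝ)..b, f x ^ 2
  set J := ∫ x in a..b, f x ^ 2
  set K := ∫ x in (0 : ℝ)..b, g x ^ 2
  set G := ∫ x in Ioi (0 : ℝ), g x ^ 2
  set V := ∫ x in (0 : ℝ)..b, x ^ p * y ^ p * f x ^ 2
  have hKG : K ≤ G := by
    refine (hIoo fun x => g x ^ 2).symm.trans_le ?_
    exact setIntegral_mono_set hgint (Filter.Eventually.of_forall fun x => sq_nonneg (g x))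
      Ioo_subset_Ioi_self.eventuallyLE
  have hG : 0 ≤ G := integral_nonneg fun x => sq_nonneg (g x)
  have hcont : Continuous fun x : ℝ => x ^ p * y ^ p * f x ^ 2 :=
    ((continuous_id.rpow_const fun _ => Or.inr hp).mul continuous_const).mul (hfc.pow 2)
  have hJV : w * J ≤ V := by
    calc w * J = ∫ x in a..b, w * f x ^ 2 := (intervalIntegral.integral_const_mul _ _).symm
      _ ≤ ∫ x in a..b, x ^ p * y ^ p * f x ^ 2 := by
        refine intervalIntegral.integral_mono_on hab
          (Continuous.intervalIntegrable (by fun_prop) _ _) (hcont.intervalIntegrable _ _) ?_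
        intro x hx
        rw [← hpw]
        gcongr
        exact hx.1
      _ ≤ V := by
        refine intervalIntegral.integral_mono_interval ha.le hab le_rfl ?_
          (hcont.intervalIntegrable _ _)
        filter_upwards [ae_restrict_mem measurableSet_Ioc] with x hx
        have := hx.1
        simp only [Pi.zero_apply]
        positivity
  have hI : w * I ≤ 2 * ((1 + δ) / δ) * (w * J) + 2 * (1 + δ) ^ 2 * K := by
    refine le_of_mul_le_mul_left ?_ (mul_pos hδ ha)
    calc δ * a * (w * I) = w * ((b - a) * I) := by rw [hb_def]; ring
      _ ≤ w * (2 * b * J + 2 * b ^ 2 * (b - a) * K) := by gcongr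
      _ = 2 * (1 + δ) * a * w * J + 2 * (1 + δ) ^ 2 * δ * a * K * (a ^ 2 * w) := by
        rw [hb_def]; ring
      _ = δ * a * (2 * ((1 + δ) / δ) * (w * J) + 2 * (1 + δ) ^ 2 * K) := by
        rw [haw]; field_simp
  calc w * I ≤ 2 * ((1 + δ) / δ) * (w * J) + 2 * (1 + δ) ^ 2 * K := hI
    _ ≤ 2 * ((1 + δ) / δ) * V + (5 / 2) * (1 + δ) ^ 2 * G := by
      gcongr 2 * ((1 + δ) / δ) * ?_ + ?_
      nlinarith [mul_le_mul_of_nonneg_left hKG (sq_nonneg (1 + δ)),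
        mul_nonneg (sq_nonneg (1 + δ)) hG]
    _ = _ := add_comm _ _

/-- estimate of the weighted mass of `ψ` inside the hyperbolic valley. -/
theorem valley_mass_estimate (p : ℝ) (hp : 1 ≤ p) (δ : ℝ) (hδ : 0 < δ)
    (ψ : ℝ × ℝ → ℝ) (hψ : ContDiff ℝ (⊤ : ℕ∞) ψ) (hsupp : HasCompactSupport ψ) :
    (∫ y in Set.Ioi (1 : ℝ), ∫ x in Set.Ioo (0 : ℝ) ((1 + δ) * y ^ (-(p / (p + 2)))),
        y ^ (2 * p / (p + 2)) * (ψ (x, y)) ^ 2) ≤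
      (5 / 2) * (1 + δ) ^ 2 * (∫ y in Set.Ioi (1 : ℝ), ∫ x in Set.Ioi (0 : ℝ),
        (fderiv ℝ ψ (x, y) (1, 0)) ^ 2) +
      2 * ((1 + δ) / δ) * (∫ y in Set.Ioi (1 : ℝ),
        ∫ x in Set.Ioo (0 : ℝ) ((1 + δ) * y ^ (-(p / (p + 2)))),
          x ^ p * y ^ p * (ψ (x, y)) ^ 2) := by
  have hp0 : 0 ≤ p := zero_le_one.trans hp
  have hψc : Continuous ψ := hψ.continuous
  have hDc : Continuous fun z : ℝ × ℝ => fderiv ℝ ψ z (1, 0) :=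
    (hψ.continuous_fderiv (by simp)).clm_apply continuous_const
  have hDsupp : HasCompactSupport fun z : ℝ × ℝ => fderiv ℝ ψ z (1, 0) := hsupp.fderiv_apply ℝ _
  have hD2 : Continuous fun z : ℝ × ℝ => (fderiv ℝ ψ z (1, 0)) ^ 2 := hDc.pow 2
  have hD2supp : HasCompactSupport fun z : ℝ × ℝ => (fderiv ℝ ψ z (1, 0)) ^ 2 :=
    hDsupp.comp_left (g := fun r : ℝ => r ^ 2) (by simp)
  have hGint : IntegrableOn
      (fun y => ∫ x in Ioi (0 : ℝ), (fderiv ℝ ψ (x, y) (1, 0)) ^ 2) (Ioi 1) := by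
    have h := (hD2.integrable_of_hasCompactSupport hD2supp (μ := volume)).integrableOn
      (s := Ioi (0 : ℝ) ×ˢ Ioi (1 : ℝ))
    rw [IntegrableOn, Measure.volume_eq_prod, ← Measure.prod_restrict] at h
    exact h.integral_prod_right
  have hVint : IntegrableOn
      (fun y => ∫ x in Ioo (0 : ℝ) ((1 + δ) * y ^ (-(p / (p + 2)))),
        x ^ p * y ^ p * (ψ (x, y)) ^ 2) (Ioi 1) := by
    have hc : Continuous fun z : ℝ × ℝ => z.1 ^ p * z.2 ^ p * ψ z ^ 2 :=
      ((continuous_fst.rpow_const fun _ => Or.inr hp0).mul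
        (continuous_snd.rpow_const fun _ => Or.inr hp0)).mul (hψc.pow 2)
    have hs : HasCompactSupport fun z : ℝ × ℝ => z.1 ^ p * z.2 ^ p * ψ z ^ 2 :=
      (hsupp.comp_left (g := fun r : ℝ => r ^ 2) (by simp)).mul_left
    have hm : MeasurableSet {z : ℝ × ℝ | z.1 ∈ Ioo 0 ((1 + δ) * z.2 ^ (-(p / (p + 2))))} :=
      (measurableSet_lt measurable_const measurable_fst).inter
        (measurableSet_lt measurable_fst (by fun_prop))
    have h := (hc.integrable_of_hasCompactSupport hs (μ := volume)).indicator hm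
    rw [Measure.volume_eq_prod] at h
    refine h.integral_prod_right.integrableOn.congr (Filter.Eventually.of_forall fun y => ?_)
    dsimp only
    rw [← integral_indicator measurableSet_Ioo]
    rfl
  rw [← integral_const_mul, ← integral_const_mul,
    ← integral_add (hGint.const_mul _) (hVint.const_mul _)]
  refine integral_mono_of_nonneg ?_ ((hGint.const_mul _).add (hVint.const_mul _)) ?_
  · filter_upwards [ae_restrict_mem measurableSet_Ioi] with y hy
    have hy0 : 0 < y := zero_lt_one.trans hy
    exact integral_nonneg fun x => by dsimp only [Pi.zero_apply]; positivity
  · filter_upwards [ae_restrict_mem measurableSet_Ioi] with y hy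
    have hline : Topology.IsClosedEmbedding fun x : ℝ => (x, y) :=
      Function.LeftInverse.isClosedEmbedding (f := Prod.fst) (fun _ => rfl) continuous_fst
        (Continuous.prodMk_left y)
    refine setIntegral_valley_slice_le hp0 hδ (zero_lt_one.trans hy)
      (f := fun x => ψ (x, y)) (g := fun x => fderiv ℝ ψ (x, y) (1, 0)) (fun x => ?_)
      (hDc.comp hline.continuous) ?_
    · exact ((hψ.differentiable (by simp)) (x, y)).hasFDerivAt.comp_hasDerivAt x
        ((hasDerivAt_id x).prodMk (hasDerivAt_const x y))
    · exact ((hD2.comp hline.continuous).integrable_of_hasCompactSupport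
        (hD2supp.comp_isClosedEmbedding hline)).integrableOn
end

section
/- For every real p ≥ 1 there exists a constant C'_p > 0 such that for every natural number N and every orthonormal system Φ = {φ_1, …, φ_N} of real-valued Schwartz functions in L²(ℝ²), one has ∫_{ℝ²} ρ_Φ(x,y)^{p+1} dx dy ≤ C'_p ((ln N)^p + 1) Σ_{j=1}^N ∫_{ℝ²} |ξη|^p |φ̂_j(ξ,η)|² dξ dη, where ρ_Φ := Σ_{j=1}^N φ_j². -/
open MeasureTheory Real

/-- The (unitary, `L²`-normalized) Fourier transform on `ℝ²` of a real-valued function. -/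
noncomputable def fourier2 (φ : ℝ × ℝ → ℝ) (w : ℝ × ℝ) : ℂ :=
  ∫ v : ℝ × ℝ,
    Complex.exp (-2 * Real.pi * Complex.I * ((v.1 * w.1 + v.2 * w.2 : ℝ) : ℂ)) * (φ v : ℂ)

open scoped FourierTransform ENNReal SchwartzMap Convolution

section Fourier

variable {E : Type*} [NormedAddCommGroup E] [InnerProductSpace ℝ E] [FiniteDimensional ℝ E]
  [MeasurableSpace E] [BorelSpace E]

/-- The Fourier integral of an integrable function against a Schwartz function. -/
theorem integral_smul_fourier_eq_of_integrable {F : Type*} [NormedAddCommGroup F]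
    [NormedSpace ℂ F] [CompleteSpace F] {H : E → F} (hH : Integrable H) (g : 𝓢(E, ℂ)) :
    ∫ x, g x • 𝓕 H x = ∫ x, 𝓕 (g : E → ℂ) x • H x := by
  have := VectorFourier.integral_fourierIntegral_smul_eq_flip (μ := volume) (ν := volume)
    (L := innerₗ E) (f := (g : E → ℂ)) (g := H) Real.continuous_fourierChar
    (by exact continuous_inner) g.integrable hH
  have h2 : (innerₗ E).flip = innerₗ E := by ext; simp
  rw [h2] at this
  exact this.symm

/-- Plancherel's theorem for functions in `L¹ ∩ L²`. -/
theorem lintegral_enorm_sq_fourier {F : Type*} [NormedAddCommGroup F]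
    [InnerProductSpace ℂ F] [CompleteSpace F] {H : E → F} (hH : Integrable H) (hH2 : MemLp H 2) :
    ∫⁻ x, ‖𝓕 H x‖ₑ ^ 2 = ∫⁻ x, ‖H x‖ₑ ^ 2 := by
  have hcont : Continuous (𝓕 H) :=
    VectorFourier.fourierIntegral_continuous Real.continuous_fourierChar
      (by exact continuous_inner) hH
  have key : (𝓕 (hH2.toLp H : Lp F 2 (volume : Measure E)) : Lp F 2 (volume : Measure E))
      =ᵐ[volume] 𝓕 H := by
    refine ae_eq_of_integral_contDiff_smul_eq ?_ hcont.locallyIntegrable ?_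
    · exact (Lp.memLp _).locallyIntegrable (by norm_num)
    intro g hg hgc
    have hg' : ContDiff ℝ (⊤ : ℕ∞) (fun x => (g x : ℂ)) :=
      Complex.ofRealCLM.contDiff.comp hg
    have hgc' : HasCompactSupport (fun x => (g x : ℂ)) :=
      hgc.comp_left (g := fun t : ℝ => (t : ℂ)) (by simp)
    set G : 𝓢(E, ℂ) := hgc'.toSchwartzMap hg' with hG
    have h1 := congrArg (fun T : 𝓢'(E, F) => T G)
      (Lp.fourier_toTemperedDistribution_eq (hH2.toLp H))
    simp only [TemperedDistribution.fourier_apply, Lp.toTemperedDistribution_apply] at h1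
    have h2 := integral_smul_fourier_eq_of_integrable hH G
    have h3 : ∫ x, (𝓕 G) x • (hH2.toLp H) x = ∫ x, (𝓕 G) x • H x := by
      apply integral_congr_ae
      filter_upwards [hH2.coeFn_toLp] with x hx
      rw [hx]
    have h4 : ∀ x, G x = (g x : ℂ) := fun x => rfl
    rw [h3] at h1
    have h5 : ∫ x, G x • (𝓕 (hH2.toLp H : Lp F 2 (volume : Measure E)) :
        Lp F 2 (volume : Measure E)) x = ∫ x, G x • 𝓕 H x := by
      rw [← h1, h2]
      rfl
    simpa [h4] using h5
  have e1 : eLpNorm (𝓕 H) 2 volume = eLpNorm H 2 volume := by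
    rw [← eLpNorm_congr_ae key, ← eLpNorm_congr_ae hH2.coeFn_toLp]
    have := Lp.norm_fourier_eq (hH2.toLp H)
    simp only [Lp.norm_def] at this
    exact (ENNReal.toReal_eq_toReal_iff' (Lp.eLpNorm_ne_top _) (Lp.eLpNorm_ne_top _)).1 this
  have e2 := congrArg (fun t => t ^ (2 : ℝ)) e1
  simp only [eLpNorm_eq_lintegral_rpow_enorm_toReal two_ne_zero ENNReal.ofNat_ne_top,
    ← ENNReal.rpow_mul] at e2
  simpa using e2

theorem continuous_fourier_of_integrable {F : Type*} [NormedAddCommGroup F]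
    [NormedSpace ℂ F] {H : E → F} (hH : Integrable H) : Continuous (𝓕 H) :=
  VectorFourier.fourierIntegral_continuous Real.continuous_fourierChar
    (by exact continuous_inner) hH

/-- If the frequency supports of `f` and `g` lie in `A` and `B`, and `A` meets every reflected
translate of `B` in a set of measure at most `κ`, then `∫ |𝓕 f|² |𝓕 g|² ≤ κ ‖f‖² ‖g‖²`. -/
theorem lintegral_fourier_mul_le {f g : E → ℂ} (hf : Integrable f) (hg : Integrable g)
    (hfm : Measurable f) (hgm : Measurable g)
    (hf2 : MemLp f 2) (hg2 : MemLp g 2) {A B : Set E} (hA : MeasurableSet A)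
    (hB : MeasurableSet B) (hfA : ∀ x ∉ A, f x = 0) (hgB : ∀ x ∉ B, g x = 0) {κ : ℝ≥0∞}
    (hκ : κ ≠ ∞)
    (h : ∀ w, volume (A ∩ {v | w - v ∈ B}) ≤ κ) :
    ∫⁻ x, ‖𝓕 f x‖ₑ ^ 2 * ‖𝓕 g x‖ₑ ^ 2 ≤
      κ * (∫⁻ x, ‖f x‖ₑ ^ 2) * ∫⁻ x, ‖g x‖ₑ ^ 2 := by
  set c : E → ℂ := f ⋆[ContinuousLinearMap.mul ℂ ℂ, volume] g with hc
  have hci : Integrable c := hf.integrable_convolution _ hg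
  have hpt : ∀ w, ‖c w‖ₑ ^ 2 ≤ κ * ∫⁻ v, ‖f v‖ₑ ^ 2 * ‖g (w - v)‖ₑ ^ 2 := by
    intro w
    have h1 : ‖c w‖ₑ ≤ ∫⁻ v, ‖f v * g (w - v)‖ₑ := by
      simpa [hc, convolution_def] using
        enorm_integral_le_lintegral_enorm (μ := volume) (fun v => f v * g (w - v))
    set S := A ∩ {v | w - v ∈ B} with hS
    have hSm : MeasurableSet S := hA.inter ((measurable_const.sub measurable_id) hB)
    have h2 : ∫⁻ v, ‖f v * g (w - v)‖ₑ = ∫⁻ v, S.indicator 1 v * ‖f v * g (w - v)‖ₑ := by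
      congr 1
      ext v
      by_cases hv : v ∈ S
      · simp [hv]
      · have : f v * g (w - v) = 0 := by
          by_cases h' : v ∈ A
          · rw [hgB (w - v) (fun h'' => hv ⟨h', h''⟩), mul_zero]
          · rw [hfA v h', zero_mul]
        simp [this]
    have h3 := ENNReal.lintegral_mul_le_Lp_mul_Lq (μ := volume) (p := 2) (q := 2)
      Real.HolderConjugate.two_two
      (f := S.indicator 1) (g := fun v => ‖f v * g (w - v)‖ₑ)
      ((measurable_const.indicator hSm).aemeasurable)
      ((hfm.mul (hgm.comp (measurable_const.sub measurable_id))).enorm.aemeasurable)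
    have h4 : ∫⁻ v, (S.indicator (1 : E → ℝ≥0∞) v) ^ (2:ℝ) = volume S := by
      rw [← lintegral_indicator_one hSm]
      congr 1
      ext v
      by_cases hv : v ∈ S <;> simp [hv]
    rw [h4] at h3
    have h5 : ‖c w‖ₑ ≤ volume S ^ (1 / (2:ℝ)) *
        (∫⁻ v, ‖f v * g (w - v)‖ₑ ^ (2:ℝ)) ^ (1 / (2:ℝ)) := by
      refine h1.trans (h2.le.trans ?_)
      simpa using h3
    calc ‖c w‖ₑ ^ 2 ≤ (volume S ^ (1 / (2:ℝ)) *
        (∫⁻ v, ‖f v * g (w - v)‖ₑ ^ (2:ℝ)) ^ (1 / (2:ℝ))) ^ 2 := by gcongr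
      _ = volume S * ∫⁻ v, ‖f v * g (w - v)‖ₑ ^ (2:ℝ) := by
        rw [mul_pow, ← ENNReal.rpow_natCast, ← ENNReal.rpow_natCast, ← ENNReal.rpow_mul,
          ← ENNReal.rpow_mul]
        norm_num
      _ ≤ κ * ∫⁻ v, ‖f v * g (w - v)‖ₑ ^ (2:ℝ) := by gcongr; exact h w
      _ = _ := by
        congr 2
        ext v
        rw [enorm_mul, ENNReal.mul_rpow_of_nonneg _ _ (by norm_num)]
        norm_num
  have hint : ∫⁻ w, ∫⁻ v, ‖f v‖ₑ ^ 2 * ‖g (w - v)‖ₑ ^ 2 =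
      (∫⁻ x, ‖f x‖ₑ ^ 2) * ∫⁻ x, ‖g x‖ₑ ^ 2 := by
    rw [lintegral_lintegral_swap]
    · have : ∀ v, ∫⁻ w, ‖f v‖ₑ ^ 2 * ‖g (w - v)‖ₑ ^ 2 = ‖f v‖ₑ ^ 2 * ∫⁻ x, ‖g x‖ₑ ^ 2 := by
        intro v
        rw [lintegral_const_mul']
        · rw [lintegral_sub_right_eq_self (fun w => ‖g w‖ₑ ^ 2) v]
        · simp
      simp_rw [this]
      rw [lintegral_mul_const _ (by fun_prop)]
    · have h1 : Measurable fun q : E × E => ‖f q.2‖ₑ ^ 2 := by fun_prop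
      have h2 : Measurable fun q : E × E => ‖g (q.1 - q.2)‖ₑ ^ 2 := by fun_prop
      exact (h1.mul h2).aemeasurable
  have htot : ∫⁻ w, ‖c w‖ₑ ^ 2 ≤ κ * (∫⁻ x, ‖f x‖ₑ ^ 2) * ∫⁻ x, ‖g x‖ₑ ^ 2 := by
    refine (lintegral_mono hpt).trans ?_
    rw [lintegral_const_mul' _ _ hκ, hint, mul_assoc]
  have hfin : ∀ {u : E → ℂ}, MemLp u 2 → ∫⁻ x, ‖u x‖ₑ ^ 2 ≠ ∞ := by
    intro u hu
    have := (lintegral_rpow_enorm_lt_top_of_eLpNorm_lt_top (by norm_num) (by norm_num)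
      hu.eLpNorm_lt_top).ne
    simpa using this
  have hc2 : MemLp c 2 := by
    refine ⟨hci.aestronglyMeasurable, ?_⟩
    rw [eLpNorm_lt_top_iff_lintegral_rpow_enorm_lt_top (by norm_num) (by norm_num)]
    have : ∫⁻ w, ‖c w‖ₑ ^ 2 < ∞ := htot.trans_lt
      (ENNReal.mul_lt_top (ENNReal.mul_lt_top hκ.lt_top (hfin hf2).lt_top) (hfin hg2).lt_top)
    simpa using this
  calc ∫⁻ x, ‖𝓕 f x‖ₑ ^ 2 * ‖𝓕 g x‖ₑ ^ 2 = ∫⁻ x, ‖𝓕 c x‖ₑ ^ 2 := by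
        congr 1
        ext x
        rw [hc, Real.fourier_mul_convolution_eq hf hg, enorm_mul, mul_pow]
    _ = ∫⁻ x, ‖c x‖ₑ ^ 2 := lintegral_enorm_sq_fourier hci hc2
    _ ≤ _ := htot

/-- The vector of frequency-localized functions `𝓕 (1_R F j)`, evaluated at a point. -/
noncomputable def localVec {N : ℕ} (F : Fin N → E → ℂ) (R : Set E) (x : E) :
    EuclideanSpace ℂ (Fin N) :=
  WithLp.toLp 2 fun j => 𝓕 (R.indicator (F j)) x

/-- The mass of the system `F` in the frequency region `R`. -/
noncomputable def localMass {N : ℕ} (F : Fin N → E → ℂ) (R : Set E) : ℝ≥0∞ :=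
  ∑ j, ∫⁻ w in R, ‖F j w‖ₑ ^ 2

theorem enorm_localVec_sq {N : ℕ} (F : Fin N → E → ℂ) (R : Set E) (x : E) :
    ‖localVec F R x‖ₑ ^ 2 = ∑ j, ‖𝓕 (R.indicator (F j)) x‖ₑ ^ 2 := by
  rw [← ofReal_norm, ← ENNReal.ofReal_pow (norm_nonneg _), EuclideanSpace.norm_sq_eq,
    ENNReal.ofReal_sum_of_nonneg (fun _ _ => by positivity)]
  refine Finset.sum_congr rfl fun j _ => ?_
  rw [ENNReal.ofReal_pow (norm_nonneg _), ofReal_norm]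
  rfl

theorem measurable_enorm_localVec {N : ℕ} {F : Fin N → E → ℂ} {R : Set E}
    (hF : ∀ j, Integrable (F j)) (hR : MeasurableSet R) :
    Measurable fun x => ‖localVec F R x‖ₑ := by
  have : Continuous fun x => localVec F R x :=
    (PiLp.continuous_toLp 2 _).comp (continuous_pi fun j =>
      continuous_fourier_of_integrable ((hF j).indicator hR))
  exact this.measurable.enorm

theorem lintegral_indicator_enorm_sq {f : E → ℂ} {R : Set E} (hR : MeasurableSet R) :
    ∫⁻ x, ‖R.indicator f x‖ₑ ^ 2 = ∫⁻ x in R, ‖f x‖ₑ ^ 2 := by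
  rw [← lintegral_indicator hR]
  congr 1
  ext x
  by_cases hx : x ∈ R <;> simp [hx]

theorem lintegral_enorm_localVec_sq {N : ℕ} {F : Fin N → E → ℂ} {R : Set E}
    (hF : ∀ j, Integrable (F j)) (hF2 : ∀ j, MemLp (F j) 2) (hR : MeasurableSet R) :
    ∫⁻ x, ‖localVec F R x‖ₑ ^ 2 = localMass F R := by
  simp_rw [enorm_localVec_sq]
  rw [lintegral_finsetSum _ fun j _ =>
    (continuous_fourier_of_integrable ((hF j).indicator hR)).measurable.enorm.pow_const 2]
  refine Finset.sum_congr rfl fun j _ => ?_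
  rw [lintegral_enorm_sq_fourier ((hF j).indicator hR) ((hF2 j).indicator hR),
    lintegral_indicator_enorm_sq hR]

theorem lintegral_enorm_localVec_mul_le {N : ℕ} {F : Fin N → E → ℂ} {A B : Set E}
    (hFm : ∀ j, Measurable (F j))
    (hF : ∀ j, Integrable (F j)) (hF2 : ∀ j, MemLp (F j) 2) (hA : MeasurableSet A)
    (hB : MeasurableSet B) {κ : ℝ≥0∞} (hκ : κ ≠ ∞)
    (h : ∀ w, volume (A ∩ {v | w - v ∈ B}) ≤ κ) :
    ∫⁻ x, ‖localVec F A x‖ₑ ^ 2 * ‖localVec F B x‖ₑ ^ 2 ≤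
      κ * localMass F A * localMass F B := by
  have hm : ∀ {R : Set E}, MeasurableSet R → ∀ j,
      Measurable fun x => ‖𝓕 (R.indicator (F j)) x‖ₑ ^ 2 := fun hR j =>
    (continuous_fourier_of_integrable ((hF j).indicator hR)).measurable.enorm.pow_const 2
  have hmm : ∀ i j, Measurable fun x =>
      ‖𝓕 (A.indicator (F i)) x‖ₑ ^ 2 * ‖𝓕 (B.indicator (F j)) x‖ₑ ^ 2 :=
    fun i j => (hm hA i).mul (hm hB j)
  simp_rw [enorm_localVec_sq, Finset.sum_mul_sum]
  rw [lintegral_finsetSum _ fun i _ => Finset.measurable_fun_sum _ fun j _ => hmm i j]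
  rw [localMass, localMass, mul_assoc, Finset.sum_mul_sum, Finset.mul_sum]
  refine Finset.sum_le_sum fun i _ => ?_
  rw [lintegral_finsetSum _ fun j _ => hmm i j, Finset.mul_sum]
  refine Finset.sum_le_sum fun j _ => ?_
  rw [← mul_assoc]
  have := lintegral_fourier_mul_le ((hF i).indicator hA) ((hF j).indicator hB)
    ((hFm i).indicator hA) ((hFm j).indicator hB) ((hF2 i).indicator hA)
    ((hF2 j).indicator hB) hA hB (fun x hx => Set.indicator_of_notMem hx _)
    (fun x hx => Set.indicator_of_notMem hx _) hκ h
  rwa [lintegral_indicator_enorm_sq hA, lintegral_indicator_enorm_sq hB] at this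

/-- Bessel's inequality for the frequency localization of an orthonormal system. -/
theorem enorm_localVec_sq_le_volume {N : ℕ} {F : Fin N → E → ℂ} {R : Set E}
    (hF2 : ∀ j, MemLp (F j) 2)
    (ho : Orthonormal ℂ fun j => (hF2 j).toLp (F j)) (hR : MeasurableSet R)
    (hRv : volume R ≠ ∞) (x : E) :
    ‖localVec F R x‖ₑ ^ 2 ≤ volume R := by
  set h : E → ℂ := R.indicator fun w => (Real.fourierChar (inner ℝ w x) : ℂ) with hh
  have hcont : Continuous fun w : E => (Real.fourierChar (inner ℝ w x) : ℂ) := by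
    have := Real.continuous_fourierChar
    fun_prop
  have hh2 : MemLp h 2 := by
    rw [hh, memLp_indicator_iff_restrict hR]
    have : IsFiniteMeasure (volume.restrict R) := ⟨by simpa using hRv.lt_top⟩
    exact MemLp.of_bound hcont.aestronglyMeasurable 1
      (Filter.Eventually.of_forall fun w => (Circle.norm_coe _).le)
  have hcoef : ∀ j, inner ℂ ((hF2 j).toLp (F j)) (hh2.toLp h) =
      starRingEnd ℂ (𝓕 (R.indicator (F j)) x) := by
    intro j
    rw [MeasureTheory.L2.inner_def, Real.fourier_eq, ← integral_conj]
    refine integral_congr_ae ?_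
    filter_upwards [(hF2 j).coeFn_toLp, hh2.coeFn_toLp] with w h1 h2
    rw [h1, h2]
    by_cases hw : w ∈ R
    · simp [hh, hw, Circle.smul_def, AddChar.map_neg_eq_inv, ← Circle.coe_inv_eq_conj]
    · simp [hh, hw]
  have hb := ho.sum_inner_products_le (hh2.toLp h) (s := Finset.univ)
  have hnorm : ‖hh2.toLp h‖ ^ 2 = (volume R).toReal := by
    have h1 : ‖hh2.toLp h‖ₑ ^ 2 = volume R := by
      rw [Lp.enorm_toLp]
      have e : eLpNorm h 2 volume ^ (2 : ℝ) = ∫⁻ w, ‖h w‖ₑ ^ 2 := by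
        rw [eLpNorm_eq_lintegral_rpow_enorm_toReal two_ne_zero ENNReal.ofNat_ne_top,
          ← ENNReal.rpow_mul]
        simp
      rw [← ENNReal.rpow_natCast, Nat.cast_ofNat, e, hh, ← lintegral_indicator_one hR]
      congr 1
      ext w
      by_cases hw : w ∈ R
      · have : ‖(Real.fourierChar (inner ℝ w x) : ℂ)‖ₑ = 1 := by
          rw [← ofReal_norm, Circle.norm_coe, ENNReal.ofReal_one]
        simp [hw, this]
      · simp [hw]
    rw [← h1, ENNReal.toReal_pow, toReal_enorm]
  rw [hnorm] at hb
  rw [enorm_localVec_sq, ← ENNReal.ofReal_toReal hRv]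
  refine le_trans (le_of_eq ?_) (ENNReal.ofReal_le_ofReal hb)
  rw [ENNReal.ofReal_sum_of_nonneg (fun _ _ => by positivity)]
  refine Finset.sum_congr rfl fun j _ => ?_
  rw [hcoef, RCLike.norm_conj, ENNReal.ofReal_pow (norm_nonneg _), ofReal_norm]

theorem enorm_localVec_le_tsum {N : ℕ} {F : Fin N → E → ℂ} (hF : ∀ j, Integrable (F j))
    {ι : Type*} [Countable ι] {R : ι → Set E} (hR : ∀ i, MeasurableSet (R i))
    (hd : Pairwise (Function.onFun Disjoint R)) {A : Set E} (hA : MeasurableSet A)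
    (hAR : A =ᵐ[volume] ⋃ i, R i) (x : E) :
    ‖localVec F A x‖ₑ ≤ ∑' i, ‖localVec F (R i) x‖ₑ := by
  have hs : HasSum (fun i => localVec F (R i) x) (localVec F A x) := by
    have hpi : HasSum (fun i => (fun j => 𝓕 ((R i).indicator (F j)) x))
        (fun j => 𝓕 (A.indicator (F j)) x) := by
      rw [Pi.hasSum]
      intro j
      have hint : Integrable fun w => Real.fourierChar (-inner ℝ w x) • F j w :=
        (Real.fourierIntegral_convergent_iff x).2 (hF j)
      have hset : ∀ {S : Set E}, MeasurableSet S → 𝓕 (S.indicator (F j)) x =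
          ∫ w in S, Real.fourierChar (-inner ℝ w x) • F j w := by
        intro S hS
        rw [Real.fourier_eq, ← integral_indicator hS]
        congr 1
        ext w
        by_cases hw : w ∈ S <;> simp [hw]
      rw [hset hA, setIntegral_congr_set hAR]
      simp_rw [hset (hR _)]
      exact hasSum_integral_iUnion hR hd hint.integrableOn
    have := hpi.mapL ((PiLp.continuousLinearEquiv 2 ℂ (fun _ : Fin N => ℂ)).symm :
      (Fin N → ℂ) →L[ℂ] EuclideanSpace ℂ (Fin N))
    exact this
  rw [← hs.tsum_eq]
  exact enorm_tsum_le_tsum_enorm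

end Fourier

theorem tsum_int_half_pow_natAbs_le (c : ℤ) {t : ℝ} (ht : 0 ≤ t) :
    ∑' n : ℤ, ENNReal.ofReal ((1 / 2) ^ (n - c).natAbs * t) ≤ ENNReal.ofReal (4 * t) := by
  have h1 : HasSum (fun n : ℕ => (1 / 2 : ℝ) ^ ((n : ℤ).natAbs)) 2 := by
    simpa using hasSum_geometric_two
  have h2 : HasSum (fun n : ℕ => (1 / 2 : ℝ) ^ ((-((n : ℤ) + 1)).natAbs)) 1 := by
    convert hasSum_geometric_two' (1 : ℝ) using 2 with n
    have : (-((n : ℤ) + 1)).natAbs = n + 1 := by omega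
    rw [this, pow_succ, one_div_pow]
    ring
  have h3 : HasSum (fun n : ℤ => (1 / 2 : ℝ) ^ n.natAbs) (2 + 1) :=
    HasSum.of_nat_of_neg_add_one h1 h2
  have h4 : HasSum (fun n : ℤ => (1 / 2 : ℝ) ^ (n - c).natAbs * t) ((2 + 1) * t) :=
    (((Equiv.subRight c).hasSum_iff (f := fun n : ℤ => (1 / 2 : ℝ) ^ n.natAbs)).2 h3).mul_right t
  rw [← ENNReal.ofReal_tsum_of_nonneg (fun n => by positivity) h4.summable, h4.tsum_eq]
  exact ENNReal.ofReal_le_ofReal (by linarith)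

/-- If any two entries of a bounded sequence with indices at distance at least two cannot both be
large, then the sequence is dominated by a geometric sequence around its largest entry. -/
theorem tsum_le_of_pairwise_small {a : ℤ → ℝ} {S τ : ℝ} (hS : 0 ≤ S) (hτ : 0 ≤ τ)
    (haS : ∀ b, a b ≤ S)
    (h : ∀ b b', 2 ≤ (b - b').natAbs → a b ≤ τ * (1 / 2) ^ (b - b').natAbs ∨
      a b' ≤ τ * (1 / 2) ^ (b - b').natAbs) :
    ∑' b, ENNReal.ofReal (a b) ≤ ENNReal.ofReal (4 * (2 * S + τ)) := by
  refine ENNReal.summable.tsum_le_of_sum_le fun T => ?_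
  rcases T.eq_empty_or_nonempty with rfl | hT
  · simp
  obtain ⟨c, hc, hmax⟩ := T.exists_max_image a hT
  have hb : ∀ b ∈ T, a b ≤ (1 / 2) ^ (b - c).natAbs * (2 * S + τ) := by
    intro b hb
    rcases lt_or_ge (b - c).natAbs 2 with hd | hd
    · have : (1 / 2 : ℝ) ^ 1 ≤ (1 / 2) ^ (b - c).natAbs :=
        pow_le_pow_of_le_one (by norm_num) (by norm_num) (by omega)
      nlinarith [haS b]
    · have h1 : a b ≤ τ * (1 / 2) ^ (b - c).natAbs := by
        rcases h b c hd with h | h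
        · exact h
        · exact (hmax b hb).trans h
      have : 0 ≤ (1 / 2 : ℝ) ^ (b - c).natAbs := by positivity
      nlinarith
  calc ∑ b ∈ T, ENNReal.ofReal (a b)
      ≤ ∑ b ∈ T, ENNReal.ofReal ((1 / 2) ^ (b - c).natAbs * (2 * S + τ)) :=
        Finset.sum_le_sum fun b hb' => ENNReal.ofReal_le_ofReal (hb b hb')
    _ ≤ ∑' b, ENNReal.ofReal ((1 / 2) ^ (b - c).natAbs * (2 * S + τ)) := ENNReal.sum_le_tsum T
    _ ≤ _ := tsum_int_half_pow_natAbs_le c (by positivity)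

/-- Pointwise dichotomy: either some hyperbolic level is large at the
given point, or two distant blocks of the same level are. -/
theorem large_level_or_large_pair {p : ℝ} (hp : 1 ≤ p) {M s : ℝ} (hM : 1 ≤ M) (hs : 0 < s)
    {u : ℤ → ℝ} {a : ℤ → ℤ → ℝ}
    (haK : ∀ m b, a m b ^ 2 ≤ 2 ^ 7 * (16 : ℝ) ^ m * M)
    (hsu : ENNReal.ofReal s ≤ ∑' m, ENNReal.ofReal (u m))
    (hua : ∀ m, ENNReal.ofReal (u m) ≤ ∑' b, ENNReal.ofReal (a m b)) :
    (∃ m, (s ^ 2) ^ (p + 1) ≤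
        (64 * (2 ^ 25) ^ p) * M ^ p * ((16 : ℝ) ^ m) ^ p * u m ^ 2) ∨
      ∃ m b b', 2 ≤ (b - b').natAbs ∧ (s ^ 2) ^ (p + 1) ≤
        (2 ^ 24 * (2 ^ 19) ^ (p - 1)) * ((16 : ℝ) ^ m * M) ^ (p - 1) *
          (16 ^ (b - b').natAbs) ^ (p + 1) * (a m b ^ 2 * a m b' ^ 2) := by
  by_contra! hcon
  obtain ⟨hcon1, hcon2⟩ := hcon
  obtain ⟨μ, hμ1, hμ2⟩ := exists_mem_Ico_zpow (x := s ^ 2 / (2 ^ 21 * M)) (y := (16 : ℝ))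
    (by positivity) (by norm_num)
  rw [le_div_iff₀ (by positivity)] at hμ1
  rw [div_lt_iff₀ (by positivity), zpow_add_one₀ (by norm_num)] at hμ2
  have hp1 : ∀ {x : ℝ}, 0 < x → x ^ (p + 1) = x ^ p * x := fun hx => by
    rw [rpow_add hx, rpow_one]
  suffices hu : ∀ m, u m ≤ (1 / 2) ^ (m - μ).natAbs * (s / 8) by
    have h1 := hsu.trans ((ENNReal.tsum_le_tsum fun m => ENNReal.ofReal_le_ofReal (hu m)).trans
      (tsum_int_half_pow_natAbs_le μ (by positivity)))
    rw [ENNReal.ofReal_le_ofReal_iff (by positivity)] at h1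
    linarith
  intro m
  set δ := (m - μ).natAbs with hδ
  have h16 : (0 : ℝ) < 16 ^ μ := by positivity
  have h16m : (0 : ℝ) < 16 ^ m := by positivity
  have h4le : (1 : ℝ) ≤ 4 ^ δ := one_le_pow₀ (by norm_num)
  rcases lt_or_ge μ m with hm | hm
  · by_contra! hlt
    have hlt' : s < 8 * 2 ^ δ * u m := by
      have h2 : (1 / 2 : ℝ) ^ δ * 2 ^ δ = 1 := by rw [← mul_pow]; norm_num
      have h3 : (0 : ℝ) < 2 ^ δ := by positivity
      nlinarith [mul_lt_mul_of_pos_right hlt h3]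
    have hQ : s ^ 2 ≤ 64 * 4 ^ δ * u m ^ 2 := by
      have : (8 * 2 ^ δ * u m) ^ 2 = 64 * 4 ^ δ * u m ^ 2 := by
        rw [mul_pow, mul_pow, ← pow_mul, mul_comm δ 2, pow_mul]; norm_num
      rw [← this]
      gcongr
    refine (hcon1 m).not_ge ?_
    rw [hp1 (by positivity)]
    have hmδ : (16 : ℝ) ^ m = 16 ^ μ * 16 ^ δ := by
      rw [← zpow_natCast, ← zpow_add₀ (by norm_num)]
      congr 1; omega
    have h5 : (s ^ 2) ^ p ≤ (2 ^ 25) ^ p * M ^ p * (16 ^ μ) ^ p := by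
      rw [← mul_rpow (by positivity) (by positivity), ← mul_rpow (by positivity) (by positivity)]
      refine rpow_le_rpow (by positivity) ?_ (by linarith)
      nlinarith
    have h6 : (4 : ℝ) ^ δ ≤ (16 ^ δ) ^ p :=
      calc (4 : ℝ) ^ δ ≤ 16 ^ δ := by gcongr; norm_num
        _ ≤ (16 ^ δ) ^ p := self_le_rpow_of_one_le (one_le_pow₀ (by norm_num)) hp
    rw [hmδ, mul_rpow (by positivity) (by positivity)]
    calc (s ^ 2) ^ p * s ^ 2
        ≤ ((2 ^ 25) ^ p * M ^ p * (16 ^ μ) ^ p) * (64 * (16 ^ δ) ^ p * u m ^ 2) := by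
          gcongr
          exact hQ.trans (by gcongr)
      _ = _ := by ring
  · have hmδ : (16 : ℝ) ^ μ = 16 ^ m * 16 ^ δ := by
      rw [← zpow_natCast, ← zpow_add₀ (by norm_num)]
      congr 1; omega
    have h164 : (16 : ℝ) ^ δ = 4 ^ δ * 4 ^ δ := by rw [← mul_pow]; norm_num
    have h24 : ∀ n : ℕ, ((1 / 2 : ℝ) ^ n) ^ 2 * 4 ^ n = 1 := fun n => by
      rw [← pow_mul, mul_comm n 2, pow_mul, ← mul_pow]; norm_num
    set e := (1 / 2 : ℝ) ^ δ with he
    have he0 : 0 < e := by positivity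
    have he4 := h24 δ
    have hpair : ∀ b b', 2 ≤ (b - b').natAbs →
        a m b ≤ (1 / 64 * e * s) * (1 / 2) ^ (b - b').natAbs ∨
        a m b' ≤ (1 / 64 * e * s) * (1 / 2) ^ (b - b').natAbs := by
      intro b b' hbb
      by_contra! hlt
      obtain ⟨hb, hb'⟩ := hlt
      refine (hcon2 m b b' hbb).not_ge ?_
      set D := (b - b').natAbs with hD
      have hd4 := h24 D
      set d := (1 / 2 : ℝ) ^ D with hd
      have hd0 : 0 < d := by positivity
      have hsq : ∀ {x : ℝ}, 1 / 64 * e * s * d < x → s ^ 2 ≤ 2 ^ 12 * 4 ^ δ * 4 ^ D * x ^ 2 := by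
        intro x hx
        have h1 : (1 / 64 * e * s * d) ^ 2 ≤ x ^ 2 := by gcongr
        calc s ^ 2 = 2 ^ 12 * (1 / 64 * e * s * d) ^ 2 * (4 ^ δ * 4 ^ D) := by
              have : (1 / 64 * e * s * d) ^ 2 * (4 ^ δ * 4 ^ D) =
                1 / 2 ^ 12 * s ^ 2 * (e ^ 2 * 4 ^ δ) * (d ^ 2 * 4 ^ D) := by ring
              rw [mul_assoc, this, he4, hd4]
              ring
          _ ≤ 2 ^ 12 * x ^ 2 * (4 ^ δ * 4 ^ D) := by gcongr
          _ = _ := by ring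
      have hsa := hsq hb
      have hsb := hsq hb'
      have hD1 : (1 : ℝ) ≤ 4 ^ D := one_le_pow₀ (by norm_num)
      have h16D : (16 : ℝ) ^ D = 4 ^ D * 4 ^ D := by rw [← mul_pow]; norm_num
      have hQ1 : s ^ 2 ≤ 2 ^ 19 * 4 ^ δ * 4 ^ D * (16 ^ m * M) :=
        calc s ^ 2 ≤ 2 ^ 12 * 4 ^ δ * 4 ^ D * a m b ^ 2 := hsa
          _ ≤ 2 ^ 12 * 4 ^ δ * 4 ^ D * (2 ^ 7 * 16 ^ m * M) := by gcongr; exact haK m b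
          _ = _ := by ring
      have hδD : (4 : ℝ) ^ δ ≤ 4 ^ D := by
        rw [hmδ, h164] at hμ1
        have hX : 0 < 16 ^ m * M * 4 ^ δ := by positivity
        refine le_of_mul_le_mul_left ?_ hX
        have h1 : 2 ^ 21 * (16 ^ m * M * 4 ^ δ * 4 ^ δ) ≤
          2 ^ 19 * (16 ^ m * M * 4 ^ δ * 4 ^ D) := by linarith
        have h2 : 0 ≤ 16 ^ m * M * 4 ^ δ * 4 ^ D := by positivity
        linarith
      have hQ2 : s ^ 2 ≤ 2 ^ 19 * 16 ^ D * (16 ^ m * M) := by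
        refine hQ1.trans ?_
        rw [h16D, ← mul_assoc (2 ^ 19 : ℝ)]
        gcongr
      have hQQ : (s ^ 2) * (s ^ 2) ≤ 2 ^ 24 * (16 ^ D) ^ 2 * (a m b ^ 2 * a m b' ^ 2) :=
        calc (s ^ 2) * (s ^ 2) ≤ (2 ^ 12 * 4 ^ δ * 4 ^ D * a m b ^ 2) *
              (2 ^ 12 * 4 ^ δ * 4 ^ D * a m b' ^ 2) := by gcongr
          _ ≤ (2 ^ 12 * 4 ^ D * 4 ^ D * a m b ^ 2) *
              (2 ^ 12 * 4 ^ D * 4 ^ D * a m b' ^ 2) := by gcongr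
          _ = _ := by rw [h16D]; ring
      have hsplit : ∀ {x : ℝ}, 0 < x → x ^ (p + 1) = x ^ (p - 1) * (x * x) := fun {x} hx => by
        rw [← pow_two, ← rpow_natCast x 2, ← rpow_add hx]
        congr 1; push_cast; ring
      rw [hsplit (x := s ^ 2) (by positivity), hsplit (x := (16 : ℝ) ^ D) (by positivity)]
      calc (s ^ 2) ^ (p - 1) * (s ^ 2 * s ^ 2)
          ≤ (2 ^ 19 * 16 ^ D * (16 ^ m * M)) ^ (p - 1) *
              (2 ^ 24 * (16 ^ D) ^ 2 * (a m b ^ 2 * a m b' ^ 2)) := by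
            gcongr
        _ = _ := by
            rw [mul_rpow (by positivity) (by positivity), mul_rpow (by positivity) (by positivity)]
            ring
    have hS : ∀ b, a m b ≤ 1 / 128 * e * s := by
      intro b
      refine abs_le_of_sq_le_sq' ?_ (by positivity) |>.2
      refine (haK m b).trans ?_
      rw [hmδ, h164] at hμ1
      have h3 : (16 : ℝ) ^ m * M * 4 ^ δ * 2 ^ 21 ≤ e ^ 2 * s ^ 2 := by
        have := mul_le_mul_of_nonneg_left hμ1 (sq_nonneg e)
        calc (16 : ℝ) ^ m * M * 4 ^ δ * 2 ^ 21
            = (e ^ 2 * 4 ^ δ) * (16 ^ m * M * 4 ^ δ * 2 ^ 21) := by rw [he4, one_mul]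
          _ = e ^ 2 * (16 ^ m * (4 ^ δ * 4 ^ δ) * (2 ^ 21 * M)) := by ring
          _ ≤ _ := this
      have h4 : (16 : ℝ) ^ m * M ≤ 16 ^ m * M * 4 ^ δ :=
        le_mul_of_one_le_right (by positivity) h4le
      nlinarith
    have hfin := (hua m).trans (tsum_le_of_pairwise_small (by positivity) (by positivity) hS hpair)
    rw [ENNReal.ofReal_le_ofReal_iff (by positivity)] at hfin
    linarith

/-- The Euclidean plane, as a product of two lines. -/
abbrev Plane : Type := WithLp 2 (ℝ × ℝ)

/-- The frequencies with `16 ^ m ≤ |ξη| < 16 ^ (m + 1)`. -/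
def hypLevel (m : ℤ) : Set Plane :=
  {w | |w.fst * w.snd| ∈ Set.Ico ((16 : ℝ) ^ m) (16 ^ (m + 1))}

/-- The frequencies of a hyperbolic level with `2 ^ (M * b) ≤ |ξ| < 2 ^ (M * (b + 1))`. -/
def hypBlock (M : ℕ) (m b : ℤ) : Set Plane :=
  hypLevel m ∩ {w | |w.fst| ∈ Set.Ico ((2 : ℝ) ^ ((M : ℤ) * b)) (2 ^ ((M : ℤ) * (b + 1)))}

theorem measurable_plane_fst : Measurable fun w : Plane => w.fst := by
  exact (WithLp.prod_continuous_ofLp 2 ℝ ℝ).fst.measurable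

theorem measurable_plane_snd : Measurable fun w : Plane => w.snd := by
  exact (WithLp.prod_continuous_ofLp 2 ℝ ℝ).snd.measurable

theorem measurableSet_hypLevel (m : ℤ) : MeasurableSet (hypLevel m) :=
  (measurable_plane_fst.mul measurable_plane_snd).abs measurableSet_Ico

theorem measurableSet_hypBlock (M : ℕ) (m b : ℤ) : MeasurableSet (hypBlock M m b) :=
  (measurableSet_hypLevel m).inter (measurable_plane_fst.abs measurableSet_Ico)

theorem pairwise_disjoint_hypLevel : Pairwise (Function.onFun Disjoint hypLevel) := by
  have h : Monotone fun m : ℤ => (16 : ℝ) ^ m := fun a b hab =>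
    zpow_le_zpow_right₀ (by norm_num) hab
  exact fun m m' hm => (h.pairwise_disjoint_on_Ico_succ hm).preimage _

theorem pairwise_disjoint_hypBlock (M : ℕ) (m : ℤ) :
    Pairwise (Function.onFun Disjoint (hypBlock M m)) := by
  have h : Monotone fun b : ℤ => (2 : ℝ) ^ ((M : ℤ) * b) := fun a b hab =>
    zpow_le_zpow_right₀ (by norm_num) (by gcongr)
  intro b b' hb
  exact ((h.pairwise_disjoint_on_Ico_succ hb).preimage fun w : Plane => |w.fst|).mono
    Set.inter_subset_right Set.inter_subset_right

theorem iUnion_hypBlock {M : ℕ} (hM : M ≠ 0) (m : ℤ) : ⋃ b, hypBlock M m b = hypLevel m := by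
  refine Set.Subset.antisymm (Set.iUnion_subset fun b => Set.inter_subset_left) fun w hw => ?_
  have hw1 : 0 < |w.fst| := by
    refine abs_pos.2 fun h0 => ?_
    have := hw.1
    rw [h0, zero_mul, abs_zero] at this
    exact this.not_gt (by positivity)
  obtain ⟨b, hb⟩ := exists_mem_Ico_zpow hw1 (one_lt_pow₀ (one_lt_two (α := ℝ)) hM)
  refine Set.mem_iUnion.2 ⟨b, hw, ?_⟩
  simpa only [Set.mem_ofPred_eq, zpow_mul, zpow_natCast] using hb

theorem volume_plane_preimage_prod (S T : Set ℝ) (hS : MeasurableSet S) (hT : MeasurableSet T) :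
    volume {w : Plane | w.fst ∈ S ∧ w.snd ∈ T} = volume S * volume T := by
  have h := (WithLp.volume_preserving_ofLp (U := ℝ) (V := ℝ)).measure_preimage
    (s := S ×ˢ T) (hS.prod hT).nullMeasurableSet
  rw [Measure.volume_eq_prod, Measure.prod_prod] at h
  exact h

theorem volume_box_le (r t c : ℝ) (hr : 0 ≤ r) :
    volume {w : Plane | |w.fst| ≤ r ∧ |c - w.snd| ≤ t} ≤ ENNReal.ofReal (4 * (r * t)) := by
  have h := volume_plane_preimage_prod (Set.Icc (-r) r) (Set.Icc (c - t) (c + t))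
    measurableSet_Icc measurableSet_Icc
  rw [Real.volume_Icc, Real.volume_Icc, ← ENNReal.ofReal_mul (by linarith)] at h
  refine le_trans (measure_mono ?_) (h.le.trans (ENNReal.ofReal_le_ofReal (by linarith)))
  rintro w ⟨h1, h2⟩
  rw [abs_le] at h1 h2
  exact ⟨h1, by constructor <;> linarith⟩

theorem iUnion_hypLevel : Set.univ =ᵐ[volume] ⋃ m, hypLevel m := by
  have h1 : volume {w : Plane | w.fst ∈ ({0} : Set ℝ) ∧ w.snd ∈ Set.univ} = 0 := by
    rw [volume_plane_preimage_prod _ _ (measurableSet_singleton _) MeasurableSet.univ]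
    simp
  have h2 : volume {w : Plane | w.fst ∈ Set.univ ∧ w.snd ∈ ({0} : Set ℝ)} = 0 := by
    rw [volume_plane_preimage_prod _ _ MeasurableSet.univ (measurableSet_singleton _)]
    simp
  symm
  rw [Filter.eventuallyEq_univ, mem_ae_iff]
  refine measure_mono_null (fun w hw => ?_) (measure_union_null h1 h2)
  by_contra hcon
  simp only [Set.mem_union, Set.mem_ofPred_eq, Set.mem_singleton_iff, Set.mem_univ, and_true,
    true_and, not_or] at hcon
  obtain ⟨m, hm⟩ := exists_mem_Ico_zpow (abs_pos.2 (mul_ne_zero hcon.1 hcon.2))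
    (by norm_num : (1 : ℝ) < 16)
  exact hw (Set.mem_iUnion.2 ⟨m, hm⟩)

theorem abs_snd_le_of_mem_hypLevel {m k : ℤ} {w : Plane} (hw : w ∈ hypLevel m)
    (hk : (2 : ℝ) ^ k ≤ |w.fst|) : |w.snd| ≤ 16 ^ (m + 1) / 2 ^ k := by
  rw [le_div_iff₀ (by positivity)]
  have := hw.2
  rw [abs_mul] at this
  nlinarith [abs_nonneg w.snd]

theorem volume_hypBlock_le (M : ℕ) (m b : ℤ) :
    volume (hypBlock M m b) ≤ ENNReal.ofReal (2 ^ 7 * (16 : ℝ) ^ m * M) := by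
  have hsub : hypBlock M m b ⊆ ⋃ i ∈ Finset.range M,
      {w : Plane | |w.fst| ≤ 2 ^ ((M : ℤ) * b + i + 1) ∧
        |0 - w.snd| ≤ 16 ^ (m + 1) / 2 ^ ((M : ℤ) * b + i)} := by
    rintro w ⟨hw, hw1, hw2⟩
    obtain ⟨k, hk1, hk2⟩ := exists_mem_Ico_zpow
      (lt_of_lt_of_le (by positivity : (0 : ℝ) < 2 ^ ((M : ℤ) * b)) hw1) (one_lt_two)
    have h1 := (zpow_lt_zpow_iff_right₀ (one_lt_two (α := ℝ))).1 (hw1.trans_lt hk2)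
    have h2 := (zpow_lt_zpow_iff_right₀ (one_lt_two (α := ℝ))).1 (hk1.trans_lt hw2)
    rw [mul_add, mul_one] at h2
    obtain ⟨i, rfl⟩ : ∃ i : ℕ, k = (M : ℤ) * b + i :=
      ⟨(k - M * b).toNat, by rw [Int.toNat_of_nonneg (by linarith)]; ring⟩
    simp only [Set.mem_iUnion, Finset.mem_range]
    refine ⟨i, by linarith [(by exact_mod_cast (by linarith : (i : ℤ) < M) : i < M)], hk2.le, ?_⟩
    rw [zero_sub, abs_neg]
    exact abs_snd_le_of_mem_hypLevel hw hk1
  refine (measure_mono hsub).trans ((measure_biUnion_finset_le _ _).trans ?_)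
  refine (Finset.sum_le_sum fun i _ => volume_box_le _ _ _ (by positivity)).trans ?_
  have : ∀ i : ℕ, 4 * ((2 : ℝ) ^ ((M : ℤ) * b + i + 1) * (16 ^ (m + 1) / 2 ^ ((M : ℤ) * b + i))) =
      2 ^ 7 * 16 ^ m := by
    intro i
    rw [zpow_add_one₀ two_ne_zero, zpow_add_one₀ (by norm_num)]
    field_simp
    norm_num
  simp_rw [this]
  rw [Finset.sum_const, Finset.card_range, nsmul_eq_mul, mul_comm, ENNReal.ofReal_mul
    (by positivity : (0 : ℝ) ≤ 2 ^ 7 * 16 ^ m), ENNReal.ofReal_natCast]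

theorem volume_hypBlock_inter_reflected_le (M : ℕ) (m b b' : ℤ) (w : Plane) :
    volume (hypBlock M m b ∩ {v | w - v ∈ hypBlock M m b'}) ≤
      ENNReal.ofReal (64 * 16 ^ m * 2 ^ ((M : ℤ) * (b + 1 - b'))) := by
  refine (measure_mono ?_).trans ((volume_box_le (2 ^ ((M : ℤ) * (b + 1)))
    (16 ^ (m + 1) / 2 ^ ((M : ℤ) * b')) w.snd (by positivity)).trans_eq ?_)
  · rintro v ⟨h1, h2⟩
    exact ⟨h1.2.2.le, abs_snd_le_of_mem_hypLevel h2.1 h2.2.1⟩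
  · congr 1
    rw [zpow_add_one₀ (by norm_num), show (M : ℤ) * (b + 1 - b') = M * (b + 1) - M * b' by ring,
      zpow_sub₀ two_ne_zero]
    ring

theorem localMass_iUnion {N : ℕ} (F : Fin N → Plane → ℂ) {ι : Type*} [Countable ι]
    {R : ι → Set Plane} (hR : ∀ i, MeasurableSet (R i))
    (hd : Pairwise (Function.onFun Disjoint R)) :
    ∑' i, localMass F (R i) = localMass F (⋃ i, R i) := by
  simp only [localMass]
  rw [Summable.tsum_finsetSum fun _ _ => ENNReal.summable]
  exact Finset.sum_congr rfl fun j _ => (lintegral_iUnion hR hd _).symm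

theorem localMass_le_card {N : ℕ} {F : Fin N → Plane → ℂ} (hF2 : ∀ j, MemLp (F j) 2)
    (ho : Orthonormal ℂ fun j => (hF2 j).toLp (F j)) (R : Set Plane) :
    localMass F R ≤ N := by
  have h : ∀ j, ∫⁻ w, ‖F j w‖ₑ ^ 2 = 1 := by
    intro j
    have e : eLpNorm (F j) 2 volume = 1 := by
      rw [← Lp.enorm_toLp (hf := hF2 j), ← ofReal_norm, ho.1 j, ENNReal.ofReal_one]
    have e2 := congrArg (fun t => t ^ (2 : ℝ)) e
    simp only [eLpNorm_eq_lintegral_rpow_enorm_toReal two_ne_zero ENNReal.ofNat_ne_top,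
      ← ENNReal.rpow_mul] at e2
    simpa using e2
  calc localMass F R ≤ ∑ j : Fin N, (1 : ℝ≥0∞) :=
        Finset.sum_le_sum fun j _ => (setLIntegral_le_lintegral _ _).trans_eq (h j)
    _ = N := by simp

/-- The weight of a pair of blocks in the pointwise bound for the density. -/
noncomputable def pairWeight (p : ℝ) (M : ℕ) (m b b' : ℤ) : ℝ :=
  if 2 ≤ (b - b').natAbs then
    (2 ^ 24 * (2 ^ 19) ^ (p - 1)) * ((16 : ℝ) ^ m * M) ^ (p - 1) *
      (16 ^ (b - b').natAbs) ^ (p + 1)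
  else 0

theorem pairWeight_nonneg (p : ℝ) (M : ℕ) (m b b' : ℤ) : 0 ≤ pairWeight p M m b b' := by
  rw [pairWeight]
  split_ifs <;> positivity

theorem enorm_localVec_univ_rpow_le {p : ℝ} (hp : 1 ≤ p) {N : ℕ} {F : Fin N → Plane → ℂ}
    (hF : ∀ j, Integrable (F j)) (hF2 : ∀ j, MemLp (F j) 2)
    (ho : Orthonormal ℂ fun j => (hF2 j).toLp (F j)) {M : ℕ} (hM : 1 ≤ M) (x : Plane) :
    (‖localVec F Set.univ x‖ₑ ^ 2) ^ (p + 1) ≤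
      ∑' m, ENNReal.ofReal ((64 * (2 ^ 25) ^ p) * M ^ p * ((16 : ℝ) ^ m) ^ p) *
          ‖localVec F (hypLevel m) x‖ₑ ^ 2 +
        ∑' m, ∑' b, ∑' b', ENNReal.ofReal (pairWeight p M m b b') *
          (‖localVec F (hypBlock M m b) x‖ₑ ^ 2 * ‖localVec F (hypBlock M m b') x‖ₑ ^ 2) := by
  rcases eq_or_ne (localVec F Set.univ x) 0 with h0 | h0
  · simp [h0, show 0 < p + 1 by linarith]
  have haK : ∀ m b, ‖localVec F (hypBlock M m b) x‖ ^ 2 ≤ 2 ^ 7 * (16 : ℝ) ^ m * M := by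
    intro m b
    have hv := volume_hypBlock_le M m b
    have := (enorm_localVec_sq_le_volume hF2 ho (measurableSet_hypBlock M m b)
      (ne_top_of_le_ne_top ENNReal.ofReal_ne_top hv) x).trans hv
    rwa [← ofReal_norm, ← ENNReal.ofReal_pow (norm_nonneg _),
      ENNReal.ofReal_le_ofReal_iff (by positivity)] at this
  have hs2 : (‖localVec F Set.univ x‖ₑ ^ 2) ^ (p + 1) =
      ENNReal.ofReal ((‖localVec F Set.univ x‖ ^ 2) ^ (p + 1)) := by
    rw [← ENNReal.ofReal_rpow_of_nonneg (by positivity) (by linarith),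
      ENNReal.ofReal_pow (norm_nonneg _), ofReal_norm]
  rw [hs2]
  rcases large_level_or_large_pair hp (M := (M : ℝ)) (s := ‖localVec F Set.univ x‖)
    (u := fun m => ‖localVec F (hypLevel m) x‖) (a := fun m b => ‖localVec F (hypBlock M m b) x‖)
    (by exact_mod_cast hM) (norm_pos_iff.2 h0) haK
    (by
      simp only [ofReal_norm]
      exact enorm_localVec_le_tsum hF measurableSet_hypLevel pairwise_disjoint_hypLevel
        MeasurableSet.univ iUnion_hypLevel x)
    (fun m => by
      simp only [ofReal_norm]
      exact enorm_localVec_le_tsum hF (measurableSet_hypBlock M m) (pairwise_disjoint_hypBlock M m)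
        (measurableSet_hypLevel m)
        (Filter.EventuallyEq.of_eq (iUnion_hypBlock (by omega) m).symm) x) with
    ⟨m, hm⟩ | ⟨m, b, b', hbb, hm⟩
  · refine le_trans ?_ (le_add_of_nonneg_right zero_le)
    refine le_trans ?_ (ENNReal.le_tsum m)
    rw [← ofReal_norm, ← ENNReal.ofReal_pow (norm_nonneg _), ← ENNReal.ofReal_mul (by positivity)]
    exact ENNReal.ofReal_le_ofReal hm
  · refine le_trans ?_ (le_add_of_nonneg_left zero_le)
    refine le_trans ?_ (ENNReal.le_tsum m)
    refine le_trans ?_ (ENNReal.le_tsum b)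
    refine le_trans ?_ (ENNReal.le_tsum b')
    rw [← ofReal_norm, ← ofReal_norm, ← ENNReal.ofReal_pow (norm_nonneg _),
      ← ENNReal.ofReal_pow (norm_nonneg _), ← ENNReal.ofReal_mul (by positivity),
      ← ENNReal.ofReal_mul (pairWeight_nonneg _ _ _ _ _), pairWeight, if_pos hbb]
    exact ENNReal.ofReal_le_ofReal hm

theorem lintegral_hypBlock_mul_le {N : ℕ} {F : Fin N → Plane → ℂ}
    (hFm : ∀ j, Measurable (F j)) (hF : ∀ j, Integrable (F j)) (hF2 : ∀ j, MemLp (F j) 2)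
    (M : ℕ) (m : ℤ) {b b' : ℤ} (hbb : b ≠ b') :
    ∫⁻ x, ‖localVec F (hypBlock M m b) x‖ₑ ^ 2 * ‖localVec F (hypBlock M m b') x‖ₑ ^ 2 ≤
      ENNReal.ofReal (64 * 16 ^ m / 2 ^ (M * ((b - b').natAbs - 1))) *
        localMass F (hypBlock M m b) * localMass F (hypBlock M m b') := by
  wlog hlt : b < b' generalizing b b'
  · have := this hbb.symm (by omega)
    rw [show (b' - b).natAbs = (b - b').natAbs by omega, mul_right_comm] at this
    simpa only [mul_comm] using this
  refine lintegral_enorm_localVec_mul_le hFm hF hF2 (measurableSet_hypBlock M m b)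
    (measurableSet_hypBlock M m b') ENNReal.ofReal_ne_top fun w => ?_
  refine (volume_hypBlock_inter_reflected_le M m b b' w).trans_eq ?_
  congr 1
  rw [div_eq_mul_inv, ← zpow_natCast, ← zpow_neg]
  congr 2
  push_cast
  rw [Nat.cast_sub (by omega), Int.natCast_natAbs, abs_of_neg (by linarith)]
  push_cast
  ring

theorem lintegral_pairs_le {p : ℝ} (hp : 1 ≤ p) {N : ℕ} (hN : 1 ≤ N) {F : Fin N → Plane → ℂ}
    (hFm : ∀ j, Measurable (F j)) (hF : ∀ j, Integrable (F j)) (hF2 : ∀ j, MemLp (F j) 2)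
    (ho : Orthonormal ℂ fun j => (hF2 j).toLp (F j)) {M : ℕ} (hM : 1 ≤ M)
    (hMN : ∀ D : ℕ, 2 ≤ D → ((16 : ℝ) ^ D) ^ (p + 1) * N ≤ 2 ^ (M * (D - 1))) (m : ℤ) :
    ∑' b, ∑' b', ENNReal.ofReal (pairWeight p M m b b') *
        ∫⁻ x, ‖localVec F (hypBlock M m b) x‖ₑ ^ 2 * ‖localVec F (hypBlock M m b') x‖ₑ ^ 2 ≤
      ENNReal.ofReal (2 ^ 30 * (2 ^ 19) ^ (p - 1) * M ^ p * ((16 : ℝ) ^ m) ^ p) *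
        localMass F (hypLevel m) := by
  have hN0 : (0 : ℝ) < N := by exact_mod_cast hN
  have hM1 : (1 : ℝ) ≤ M := by exact_mod_cast hM
  set K : ℝ := 2 ^ 30 * (2 ^ 19) ^ (p - 1) * M ^ p * ((16 : ℝ) ^ m) ^ p with hK
  have hterm : ∀ b b', ENNReal.ofReal (pairWeight p M m b b') *
      ∫⁻ x, ‖localVec F (hypBlock M m b) x‖ₑ ^ 2 * ‖localVec F (hypBlock M m b') x‖ₑ ^ 2 ≤
      ENNReal.ofReal (K / N) * localMass F (hypBlock M m b) *
        localMass F (hypBlock M m b') := by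
    intro b b'
    rw [pairWeight]
    split_ifs with hD
    swap
    · simp
    refine (mul_le_mul_right (lintegral_hypBlock_mul_le hFm hF hF2 M m
      (by rintro rfl; simp at hD)) _).trans ?_
    rw [← mul_assoc, ← mul_assoc, ← ENNReal.ofReal_mul (by positivity)]
    gcongr
    set D := (b - b').natAbs
    rw [le_div_iff₀ hN0]
    have h1 := hMN D hD
    have h2 : (16 : ℝ) ^ m * ((16 : ℝ) ^ m) ^ (p - 1) = (16 ^ m) ^ p := by
      rw [← rpow_one_add' (by positivity) (by linarith)]
      congr 1; ring
    have h3 : (M : ℝ) ^ (p - 1) ≤ M ^ p := rpow_le_rpow_of_exponent_le hM1 (by linarith)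
    calc _ = 2 ^ 30 * (2 ^ 19) ^ (p - 1) * ((16 : ℝ) ^ m * ((16 : ℝ) ^ m) ^ (p - 1)) *
          (M : ℝ) ^ (p - 1) * (((16 : ℝ) ^ D) ^ (p + 1) * N / 2 ^ (M * (D - 1))) := by
          rw [mul_rpow (by positivity) (by positivity)]
          ring
      _ ≤ 2 ^ 30 * (2 ^ 19) ^ (p - 1) * ((16 : ℝ) ^ m * ((16 : ℝ) ^ m) ^ (p - 1)) *
          (M : ℝ) ^ p * 1 := by
          gcongr
          exact div_le_one_of_le₀ h1 (by positivity)
      _ = K := by rw [h2, hK]; ring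
  have hsum : ∑' b, localMass F (hypBlock M m b) = localMass F (hypLevel m) := by
    rw [localMass_iUnion F (measurableSet_hypBlock M m) (pairwise_disjoint_hypBlock M m),
      iUnion_hypBlock (by omega)]
  refine (ENNReal.tsum_le_tsum fun b => ENNReal.tsum_le_tsum fun b' => hterm b b').trans ?_
  simp_rw [ENNReal.tsum_mul_left, ENNReal.tsum_mul_right, ENNReal.tsum_mul_left, hsum]
  refine mul_le_mul_left ((mul_le_mul_right (localMass_le_card hF2 ho _) _).trans_eq ?_) _
  rw [← ENNReal.ofReal_natCast, ← ENNReal.ofReal_mul (by positivity), div_mul_cancel₀ _ hN0.ne']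

theorem tsum_hypLevel_mass_le {p : ℝ} (hp : 1 ≤ p) {N : ℕ} (F : Fin N → Plane → ℂ) :
    ∑' m, ENNReal.ofReal (((16 : ℝ) ^ m) ^ p) * localMass F (hypLevel m) ≤
      ∑ j, ∫⁻ w : Plane, ENNReal.ofReal (|w.fst * w.snd| ^ p) * ‖F j w‖ₑ ^ 2 := by
  simp only [localMass, Finset.mul_sum]
  rw [Summable.tsum_finsetSum fun _ _ => ENNReal.summable]
  refine Finset.sum_le_sum fun j _ => ?_
  refine le_trans ?_ (setLIntegral_le_lintegral (⋃ m, hypLevel m) _)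
  rw [lintegral_iUnion measurableSet_hypLevel pairwise_disjoint_hypLevel]
  refine ENNReal.tsum_le_tsum fun m => ?_
  rw [← lintegral_const_mul' _ _ ENNReal.ofReal_ne_top]
  refine setLIntegral_mono' (measurableSet_hypLevel m) fun w hw => ?_
  gcongr
  exact hw.1

/-- Lieb–Thirring bound for the density of a system given by its Fourier transforms. -/
theorem lintegral_enorm_localVec_univ_rpow_le {p : ℝ} (hp : 1 ≤ p) {N : ℕ} (hN : 1 ≤ N)
    {F : Fin N → Plane → ℂ}
    (hFm : ∀ j, Measurable (F j)) (hF : ∀ j, Integrable (F j)) (hF2 : ∀ j, MemLp (F j) 2)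
    (ho : Orthonormal ℂ fun j => (hF2 j).toLp (F j)) {M : ℕ} (hM : 1 ≤ M)
    (hMN : ∀ D : ℕ, 2 ≤ D → ((16 : ℝ) ^ D) ^ (p + 1) * N ≤ 2 ^ (M * (D - 1))) :
    ∫⁻ x, (‖localVec F Set.univ x‖ₑ ^ 2) ^ (p + 1) ≤
      ENNReal.ofReal ((64 * (2 ^ 25) ^ p + 2 ^ 30 * (2 ^ 19) ^ (p - 1)) * M ^ p) *
        ∑ j, ∫⁻ w : Plane, ENNReal.ofReal (|w.fst * w.snd| ^ p) * ‖F j w‖ₑ ^ 2 := by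
  have hml : ∀ m, Measurable fun x =>
      ENNReal.ofReal ((64 * (2 ^ 25) ^ p) * M ^ p * ((16 : ℝ) ^ m) ^ p) *
        ‖localVec F (hypLevel m) x‖ₑ ^ 2 := fun m =>
    ((measurable_enorm_localVec hF (measurableSet_hypLevel m)).pow_const 2).const_mul _
  have hmb := fun m b =>
    (measurable_enorm_localVec hF (measurableSet_hypBlock M m b)).pow_const 2
  have hmp : ∀ m b b', Measurable fun x => ENNReal.ofReal (pairWeight p M m b b') *
      (‖localVec F (hypBlock M m b) x‖ₑ ^ 2 * ‖localVec F (hypBlock M m b') x‖ₑ ^ 2) :=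
    fun m b b' => ((hmb m b).mul (hmb m b')).const_mul _
  have hmp1 : ∀ m b, Measurable fun x => ∑' b', ENNReal.ofReal (pairWeight p M m b b') *
      (‖localVec F (hypBlock M m b) x‖ₑ ^ 2 * ‖localVec F (hypBlock M m b') x‖ₑ ^ 2) :=
    fun m b => Measurable.tsum (hmp m b)
  have hmp2 : ∀ m, Measurable fun x => ∑' b, ∑' b', ENNReal.ofReal (pairWeight p M m b b') *
      (‖localVec F (hypBlock M m b) x‖ₑ ^ 2 * ‖localVec F (hypBlock M m b') x‖ₑ ^ 2) :=
    fun m => Measurable.tsum (hmp1 m)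
  refine (lintegral_mono fun x => enorm_localVec_univ_rpow_le hp hF hF2 ho hM x).trans ?_
  rw [lintegral_add_left (Measurable.tsum hml),
    lintegral_tsum fun m => (hml m).aemeasurable,
    lintegral_tsum fun m => (hmp2 m).aemeasurable]
  simp_rw [lintegral_const_mul' _ _ ENNReal.ofReal_ne_top,
    lintegral_enorm_localVec_sq hF hF2 (measurableSet_hypLevel _)]
  have hpair : ∀ m, ∫⁻ x, ∑' b, ∑' b', ENNReal.ofReal (pairWeight p M m b b') *
      (‖localVec F (hypBlock M m b) x‖ₑ ^ 2 * ‖localVec F (hypBlock M m b') x‖ₑ ^ 2) ≤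
      ENNReal.ofReal (2 ^ 30 * (2 ^ 19) ^ (p - 1) * M ^ p * ((16 : ℝ) ^ m) ^ p) *
        localMass F (hypLevel m) := by
    intro m
    refine le_of_eq_of_le ?_ (lintegral_pairs_le hp hN hFm hF hF2 ho hM hMN m)
    rw [lintegral_tsum fun b => (hmp1 m b).aemeasurable]
    refine tsum_congr fun b => ?_
    rw [lintegral_tsum fun b' => (hmp m b b').aemeasurable]
    exact tsum_congr fun b' => lintegral_const_mul' _ _ ENNReal.ofReal_ne_top
  refine (add_le_add_right (ENNReal.tsum_le_tsum hpair) _).trans ?_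
  rw [← ENNReal.tsum_add]
  refine le_trans (le_of_eq ?_) (mul_le_mul_right (tsum_hypLevel_mass_le hp F) _)
  rw [← ENNReal.tsum_mul_left]
  refine tsum_congr fun m => ?_
  rw [← add_mul, ← ENNReal.ofReal_add (by positivity) (by positivity), ← mul_assoc,
    ← ENNReal.ofReal_mul (by positivity)]
  congr 2
  ring

/-- A real Schwartz function on `ℝ × ℝ`, as a complex Schwartz function on the Euclidean plane. -/
noncomputable def planeSchwartz (φ : 𝓢(ℝ × ℝ, ℝ)) : 𝓢(Plane, ℂ) :=
  SchwartzMap.postcompCLM Complex.ofRealCLM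
    (SchwartzMap.compCLMOfContinuousLinearEquiv ℝ (WithLp.prodContinuousLinearEquiv 2 ℝ ℝ ℝ) φ)

/-- The inverse Fourier transform of a real Schwartz function on the Euclidean plane. -/
noncomputable def planeFourierInv (φ : 𝓢(ℝ × ℝ, ℝ)) : 𝓢(Plane, ℂ) :=
  𝓕⁻ (planeSchwartz φ)

theorem fourier_planeFourierInv (φ : 𝓢(ℝ × ℝ, ℝ)) :
    𝓕 (planeFourierInv φ) = planeSchwartz φ :=
  FourierTransform.fourier_fourierInv_eq _

theorem planeSchwartz_apply (φ : 𝓢(ℝ × ℝ, ℝ)) (x : Plane) :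
    planeSchwartz φ x = (φ (WithLp.ofLp x) : ℂ) := rfl

theorem integral_plane_eq {G : Type*} [NormedAddCommGroup G] [NormedSpace ℝ G]
    (g : ℝ × ℝ → G) : ∫ x : Plane, g (WithLp.ofLp x) = ∫ v, g v :=
  (WithLp.volume_preserving_ofLp (U := ℝ) (V := ℝ)).integral_comp
    (MeasurableEquiv.toLp 2 (ℝ × ℝ)).symm.measurableEmbedding g

theorem lintegral_plane_eq (g : ℝ × ℝ → ℝ≥0∞) :
    ∫⁻ x : Plane, g (WithLp.ofLp x) = ∫⁻ v, g v :=
  (WithLp.volume_preserving_ofLp (U := ℝ) (V := ℝ)).lintegral_comp_emb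
    (MeasurableEquiv.toLp 2 (ℝ × ℝ)).symm.measurableEmbedding g

theorem norm_planeFourierInv (φ : 𝓢(ℝ × ℝ, ℝ)) (w : Plane) :
    ‖planeFourierInv φ w‖ = ‖fourier2 φ (WithLp.ofLp w)‖ := by
  rw [← RCLike.norm_conj (fourier2 φ (WithLp.ofLp w)), fourier2, ← integral_conj,
    planeFourierInv, SchwartzMap.fourierInv_coe, Real.fourierInv_eq', ← integral_plane_eq]
  congr 2
  ext v
  rw [planeSchwartz_apply, map_mul, ← Complex.exp_conj, WithLp.prod_inner_apply, smul_eq_mul]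
  simp only [map_mul, map_neg, Complex.conj_ofReal, Complex.conj_I, map_ofNat, RCLike.inner_apply,
    conj_trivial]
  congr 2
  push_cast
  ring

theorem inner_planeSchwartz_toLp (φ χ : 𝓢(ℝ × ℝ, ℝ)) :
    inner ℂ ((planeSchwartz φ).toLp 2) ((planeSchwartz χ).toLp 2) =
      ((∫ v, φ v * χ v : ℝ) : ℂ) := by
  rw [SchwartzMap.inner_toL2_toL2_eq _ _ volume, ← integral_plane_eq, ← integral_complex_ofReal]
  congr 1
  ext x
  simp [planeSchwartz_apply, mul_comm]

theorem orthonormal_planeFourierInv {N : ℕ} {φ : Fin N → 𝓢(ℝ × ℝ, ℝ)}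
    (h : ∀ i j : Fin N, (∫ v, φ i v * φ j v) = if i = j then 1 else 0) :
    Orthonormal ℂ fun j => (planeFourierInv (φ j)).toLp 2 := by
  rw [orthonormal_iff_ite]
  intro i j
  rw [← SchwartzMap.inner_fourier_toL2_eq, fourier_planeFourierInv,
    fourier_planeFourierInv, inner_planeSchwartz_toLp, h]
  split_ifs <;> simp

theorem integrable_rpow_mul_norm_sq (p : ℝ) (hp : 0 ≤ p) (G : 𝓢(Plane, ℂ)) :
    Integrable fun w : Plane => |w.fst * w.snd| ^ p * ‖G w‖ ^ 2 := by
  obtain ⟨C, hC⟩ := G.decay 0 0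
  have hC' : ∀ w, ‖G w‖ ≤ C := fun w => by simpa using hC.2 w
  set k := ⌈2 * p⌉₊ with hk
  have hint : Integrable fun w : Plane => C * (‖w‖ ^ 0 * ‖G w‖ + ‖w‖ ^ k * ‖G w‖) :=
    ((G.integrable_pow_mul volume 0).add (G.integrable_pow_mul volume k)).const_mul C
  refine hint.mono ?_ (Filter.Eventually.of_forall fun w => ?_)
  · have h1 : Measurable fun w : Plane => |w.fst * w.snd| ^ p :=
      (measurable_plane_fst.mul measurable_plane_snd).abs.pow_const p
    exact (h1.mul (G.continuous.norm.pow 2).measurable).aestronglyMeasurable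
  · have hw1 : |w.fst| ≤ ‖w‖ := WithLp.norm_fst_le (x := w)
    have hw2 : |w.snd| ≤ ‖w‖ := WithLp.norm_snd_le (x := w)
    have hprod : |w.fst * w.snd| ^ p ≤ 1 + ‖w‖ ^ k := by
      calc |w.fst * w.snd| ^ p ≤ (‖w‖ ^ (2 : ℝ)) ^ p := by
            rw [abs_mul, rpow_two, pow_two]
            gcongr
        _ = ‖w‖ ^ (2 * p) := by rw [← rpow_mul (norm_nonneg _)]
        _ ≤ 1 + ‖w‖ ^ k := by
            rcases le_total ‖w‖ 1 with h | h
            · have h1 := rpow_le_one (norm_nonneg w) h (by positivity : 0 ≤ 2 * p)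
              have h2 : 0 ≤ ‖w‖ ^ k := by positivity
              linarith
            · have h1 := rpow_le_rpow_of_exponent_le h (Nat.le_ceil (2 * p))
              rw [rpow_natCast] at h1
              linarith
    refine le_trans ?_ (le_abs_self _)
    rw [norm_of_nonneg (by positivity)]
    calc |w.fst * w.snd| ^ p * ‖G w‖ ^ 2 ≤ (1 + ‖w‖ ^ k) * (C * ‖G w‖) := by
          rw [pow_two]
          gcongr
          exact hC' w
      _ = _ := by ring

theorem enorm_localVec_fourierInv_sq {N : ℕ} (φ : Fin N → 𝓢(ℝ × ℝ, ℝ)) (x : Plane) :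
    ‖localVec (fun j => ⇑(planeFourierInv (φ j))) Set.univ x‖ₑ ^ 2 =
      ENNReal.ofReal (∑ j, φ j (WithLp.ofLp x) ^ 2) := by
  rw [enorm_localVec_sq, ENNReal.ofReal_sum_of_nonneg fun _ _ => by positivity]
  refine Finset.sum_congr rfl fun j _ => ?_
  rw [Set.indicator_univ, ← SchwartzMap.fourier_coe, fourier_planeFourierInv,
    planeSchwartz_apply, ← ofReal_norm, ← ENNReal.ofReal_pow (norm_nonneg _), Complex.norm_real,
    norm_eq_abs, sq_abs]

/-- The Lieb–Thirring bound with a block length adapted to the size of the system. -/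
theorem integral_density_rpow_le {p : ℝ} (hp : 1 ≤ p) {N : ℕ} (hN : 1 ≤ N)
    {φ : Fin N → 𝓢(ℝ × ℝ, ℝ)}
    (h : ∀ i j : Fin N, (∫ v, φ i v * φ j v) = if i = j then 1 else 0) {M : ℕ} (hM : 1 ≤ M)
    (hMN : ∀ D : ℕ, 2 ≤ D → ((16 : ℝ) ^ D) ^ (p + 1) * N ≤ 2 ^ (M * (D - 1))) :
    ∫ v, (∑ j, φ j v ^ 2) ^ (p + 1) ≤
      (64 * (2 ^ 25) ^ p + 2 ^ 30 * (2 ^ 19) ^ (p - 1)) * M ^ p *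
        ∑ j, ∫ w : ℝ × ℝ, |w.1 * w.2| ^ p * ‖fourier2 (φ j) w‖ ^ 2 := by
  have key := lintegral_enorm_localVec_univ_rpow_le hp hN
    (F := fun j => ⇑(planeFourierInv (φ j)))
    (fun j => (SchwartzMap.continuous _).measurable) (fun j => SchwartzMap.integrable _)
    (fun j => (planeFourierInv (φ j)).memLp 2) (orthonormal_planeFourierInv h) hM hMN
  have hrhs : ∀ j, ∫⁻ w : Plane, ENNReal.ofReal (|w.fst * w.snd| ^ p) *
      ‖planeFourierInv (φ j) w‖ₑ ^ 2 =
      ENNReal.ofReal (∫ w : ℝ × ℝ, |w.1 * w.2| ^ p * ‖fourier2 (φ j) w‖ ^ 2) := by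
    intro j
    rw [← integral_plane_eq fun w => |w.1 * w.2| ^ p * ‖fourier2 (φ j) w‖ ^ 2]
    simp_rw [← norm_planeFourierInv]
    refine Eq.symm ((ofReal_integral_eq_lintegral_ofReal
      (integrable_rpow_mul_norm_sq p (by linarith) (planeFourierInv (φ j)))
      (Filter.Eventually.of_forall fun w => by positivity)).trans ?_)
    congr 1
    ext w
    rw [ENNReal.ofReal_mul (by positivity), ENNReal.ofReal_pow (norm_nonneg _), ofReal_norm]
  have hpos : ∀ v, 0 ≤ ∑ j, φ j v ^ 2 := fun v => Finset.sum_nonneg fun j _ => sq_nonneg _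
  have hrpos : ∀ j, 0 ≤ ∫ w : ℝ × ℝ, |w.1 * w.2| ^ p * ‖fourier2 (φ j) w‖ ^ 2 :=
    fun j => integral_nonneg fun w => by positivity
  have hlhs : ∫⁻ x, (‖localVec (fun j => ⇑(planeFourierInv (φ j))) Set.univ x‖ₑ ^ 2) ^ (p + 1) =
      ∫⁻ v, ENNReal.ofReal ((∑ j, φ j v ^ 2) ^ (p + 1)) := by
    rw [← lintegral_plane_eq]
    congr 1
    ext x
    rw [enorm_localVec_fourierInv_sq, ENNReal.ofReal_rpow_of_nonneg (hpos _) (by linarith)]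
  simp_rw [hrhs] at key
  rw [hlhs, ← ENNReal.ofReal_sum_of_nonneg fun j _ => hrpos j,
    ← ENNReal.ofReal_mul (by positivity)] at key
  have hcont : Continuous fun v => (∑ j, φ j v ^ 2) ^ (p + 1) :=
    (continuous_finsetSum _ fun j _ => (φ j).continuous.pow 2).rpow_const
      fun _ => Or.inr (by linarith)
  rw [integral_eq_lintegral_of_nonneg_ae
    (Filter.Eventually.of_forall fun v => rpow_nonneg (hpos v) _) hcont.aestronglyMeasurable]
  exact ENNReal.toReal_le_of_le_ofReal
    (mul_nonneg (by positivity) (Finset.sum_nonneg fun j _ => hrpos j)) key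

theorem rpow_natCeil_mul_le (p : ℝ) (N D : ℕ) (hD : 2 ≤ D) :
    ((16 : ℝ) ^ D) ^ (p + 1) * N ≤ 2 ^ ((8 * ⌈p + 1⌉₊ + Nat.clog 2 N) * (D - 1)) := by
  have h1 : ((16 : ℝ) ^ D) ^ (p + 1) ≤ 2 ^ (4 * D * ⌈p + 1⌉₊) := by
    calc ((16 : ℝ) ^ D) ^ (p + 1) ≤ ((16 : ℝ) ^ D) ^ (⌈p + 1⌉₊ : ℝ) :=
          rpow_le_rpow_of_exponent_le (one_le_pow₀ (by norm_num)) (Nat.le_ceil _)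
      _ = 2 ^ (4 * D * ⌈p + 1⌉₊) := by
          rw [rpow_natCast, pow_mul, pow_mul]
          norm_num
  have h2 : (N : ℝ) ≤ 2 ^ Nat.clog 2 N := by
    exact_mod_cast Nat.le_pow_clog (by norm_num) N
  calc ((16 : ℝ) ^ D) ^ (p + 1) * N ≤ 2 ^ (4 * D * ⌈p + 1⌉₊) * 2 ^ Nat.clog 2 N := by gcongr
    _ = 2 ^ (4 * D * ⌈p + 1⌉₊ + Nat.clog 2 N) := (pow_add _ _ _).symm
    _ ≤ _ := by
      refine pow_le_pow_right₀ (by norm_num) ?_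
      obtain ⟨e, rfl⟩ := Nat.exists_eq_add_of_le hD
      rw [show 2 + e - 1 = e + 1 by omega]
      nlinarith [Nat.zero_le (⌈p + 1⌉₊ * e), Nat.zero_le (Nat.clog 2 N * e)]

theorem clog_two_le (N : ℕ) : (Nat.clog 2 N : ℝ) ≤ 2 * log N + 1 := by
  have hlog : 0 ≤ log N := log_natCast_nonneg N
  rcases Nat.eq_zero_or_pos (Nat.clog 2 N) with h | h
  · rw [h]
    push_cast
    linarith
  have h1 : 2 ^ (Nat.clog 2 N).pred < N := Nat.pow_pred_clog_lt_self (by norm_num) (by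
    by_contra! h'
    have := Nat.clog_of_right_le_one h' 2
    omega)
  have h2 : (2 : ℝ) ^ (Nat.clog 2 N - 1) ≤ N := by exact_mod_cast h1.le
  have h3 := log_le_log (by positivity) h2
  rw [log_pow, Nat.cast_sub h] at h3
  have h4 := log_two_gt_d9
  have h5 : (1 : ℝ) ≤ Nat.clog 2 N := by exact_mod_cast h
  push_cast at h3
  nlinarith

theorem blockLength_rpow_le {p : ℝ} (hp : 1 ≤ p) (N P : ℕ) :
    ((8 * P + Nat.clog 2 N : ℕ) : ℝ) ^ p ≤ (2 * (8 * P + 2)) ^ p * (log N ^ p + 1) := by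
  have hlog : 0 ≤ log N := log_natCast_nonneg N
  have h1 : ((8 * P + Nat.clog 2 N : ℕ) : ℝ) ≤ (8 * P + 2) * (log N + 1) := by
    push_cast
    have : 0 ≤ (P : ℝ) * log N := by positivity
    nlinarith [clog_two_le N]
  have h2 : log N + 1 ≤ 2 * max (log N) 1 := by
    linarith [le_max_left (log N) 1, le_max_right (log N) 1]
  have h3 : max (log N) 1 ^ p ≤ log N ^ p + 1 := by
    have : 0 ≤ log N ^ p := rpow_nonneg hlog p
    rcases max_choice (log N) 1 with h | h <;> rw [h]
    · linarith
    · rw [one_rpow]; linarith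
  calc ((8 * P + Nat.clog 2 N : ℕ) : ℝ) ^ p ≤ (2 * (8 * P + 2) * max (log N) 1) ^ p := by
        refine rpow_le_rpow (by positivity) (h1.trans ?_) (by linarith)
        nlinarith
    _ = (2 * (8 * P + 2)) ^ p * max (log N) 1 ^ p :=
        mul_rpow (by positivity) (by positivity)
    _ ≤ _ := by gcongr

/-- Lieb–Thirring-type estimate for orthonormal systems in `L²(ℝ²)`. -/
theorem lieb_thirring_type_estimate (p : ℝ) (hp : 1 ≤ p) :
    ∃ C : ℝ, 0 < C ∧ ∀ (N : ℕ) (φ : Fin N → SchwartzMap (ℝ × ℝ) ℝ),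
      (∀ i j : Fin N, (∫ v : ℝ × ℝ, φ i v * φ j v) = if i = j then 1 else 0) →
      (∫ v : ℝ × ℝ, (∑ j : Fin N, (φ j v) ^ 2) ^ (p + 1)) ≤
        C * ((Real.log N) ^ p + 1) *
          ∑ j : Fin N, ∫ w : ℝ × ℝ, |w.1 * w.2| ^ p * ‖fourier2 (φ j) w‖ ^ 2 := by
  refine ⟨(64 * (2 ^ 25) ^ p + 2 ^ 30 * (2 ^ 19) ^ (p - 1)) *
    (2 * (8 * ⌈p + 1⌉₊ + 2)) ^ p, by positivity, fun N φ h => ?_⟩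
  rcases Nat.eq_zero_or_pos N with rfl | hN
  · simp [zero_rpow (by linarith : p + 1 ≠ 0)]
  have hP : 0 < ⌈p + 1⌉₊ := Nat.ceil_pos.2 (by linarith)
  refine (integral_density_rpow_le hp hN h (M := 8 * ⌈p + 1⌉₊ + Nat.clog 2 N) (by omega)
    fun D hD => rpow_natCeil_mul_le p N D hD).trans ?_
  refine mul_le_mul_of_nonneg_right ?_
    (Finset.sum_nonneg fun j _ => integral_nonneg fun w => by positivity)
  rw [mul_assoc]
  exact mul_le_mul_of_nonneg_left (blockLength_rpow_le hp N _) (by positivity)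
end
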